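/- arXiv:1612.02210 — 5 statements merged into one kernel-verified Lean document; each statement's English description precedes it below -/
import Mathlib

section
/- Let A = (a_{ij}) be an m-by-n real matrix and let r ≥ 2 be an integer with r ≤ min(m,n). Then the following are equivalent: (a) A + B is TN whenever B is an m-by-n TN matrix; (b) A + B is TP whenever B is TP; (c) A + B is TN_r whenever B is TN_r; (d) A + B is TP_r whenever B is TP_r; (e) A + B is TN_2 whenever B is TN; (f) A + B is TN_2 whenever B is TP; (g) the upper-left entry a_{11} and the lower-right entry a_{mn} are nonnegative, and all other entries of A are zero. -/
/-- `A` is totally nonnegative of order `r`: every minor of size at most `r` is nonnegative. -/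
def IsTNr {m n : ℕ} (A : Matrix (Fin m) (Fin n) ℝ) (r : ℕ) : Prop :=
  ∀ (k : ℕ), k ≤ r → ∀ (f : Fin k → Fin m) (g : Fin k → Fin n),
    StrictMono f → StrictMono g → 0 ≤ (A.submatrix f g).det

/-- `A` is totally positive of order `r`: every minor of size at most `r` is positive. -/
def IsTPr {m n : ℕ} (A : Matrix (Fin m) (Fin n) ℝ) (r : ℕ) : Prop :=
  ∀ (k : ℕ), k ≤ r → ∀ (f : Fin k → Fin m) (g : Fin k → Fin n),
    StrictMono f → StrictMono g → 0 < (A.submatrix f g).det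

/-- The contiguous `k`-by-`k` submatrix of `A` with rows `a, a+1, …, a+k-1`
and columns `b, b+1, …, b+k-1`. -/
def ctgSub {m n : ℕ} (A : Matrix (Fin m) (Fin n) ℝ) (k a b : ℕ)
    (ha : a + k ≤ m) (hb : b + k ≤ n) : Matrix (Fin k) (Fin k) ℝ :=
  Matrix.of fun i j => A ⟨a + i.1, by omega⟩ ⟨b + j.1, by omega⟩

/-- `A` is a Hankel matrix: the entry `A i j` depends only on `i + j`. -/
def IsHankel {m n : ℕ} (A : Matrix (Fin m) (Fin n) ℝ) : Prop :=
  ∀ (i i' : Fin m) (j j' : Fin n), i.1 + j.1 = i'.1 + j'.1 → A i j = A i' j'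

/-- The Hadamard (entrywise) power `A^{∘t}` with real exponent `t` (via `Real.rpow`). -/
noncomputable def hadPow {m n : ℕ} (A : Matrix (Fin m) (Fin n) ℝ) (t : ℝ) :
    Matrix (Fin m) (Fin n) ℝ :=
  Matrix.of fun i j => (A i j) ^ t

open Matrix in
lemma ac_cauchy_pos : ∀ (k : ℕ) (x y : Fin k → ℝ), StrictMono x → StrictMono y →
    (∀ i, 0 < x i) → (∀ i, 0 < y i) →
    0 < (Matrix.of fun i j => 1 / (x i + y j)).det := by
  intro k
  induction k with
  | zero => intros; simp
  | succ k ih =>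
    intro x y hx hy hx0 hy0
    have hs : ∀ i j, 0 < x i + y j := fun i j => add_pos (hx0 i) (hy0 j)
    set M : Matrix (Fin (k+1)) (Fin (k+1)) ℝ := Matrix.of fun i j => 1 / (x i + y j) with hM
    let c : Fin (k+1) → ℝ := fun i => if i = 0 then 0 else -((x 0 + y 0) / (x i + y 0))
    let N : Matrix (Fin (k+1)) (Fin (k+1)) ℝ := Matrix.of fun i j => M i j + c i * M 0 j
    have h1 : N.det = M.det :=
      Matrix.det_eq_of_forall_row_eq_smul_add_const c 0 (by simp [c]) (fun i j => rfl)
    have h2 : N.det = N 0 0 * (N.submatrix Fin.succ Fin.succ).det := by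
      rw [Matrix.det_succ_column_zero, Fin.sum_univ_succ, Finset.sum_eq_zero]
      · simp
      · intro i _
        have : N i.succ 0 = 0 := by
          have := (hs i.succ 0).ne'
          have := (hs 0 0).ne'
          simp only [N, c, M, Matrix.of_apply, Fin.succ_ne_zero, if_false]
          field_simp
          ring
        simp [this]
    have h3 : N.submatrix Fin.succ Fin.succ = Matrix.of fun i j : Fin k =>
        ((x i.succ - x 0) / (x i.succ + y 0)) * (Matrix.of fun i j : Fin k =>
        ((y j.succ - y 0) / (x 0 + y j.succ)) *
          (Matrix.of fun i j : Fin k => 1 / (x i.succ + y j.succ)) i j) i j := by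
      ext i j
      have := (hs i.succ 0).ne'
      have := (hs 0 0).ne'
      have := (hs 0 j.succ).ne'
      have := (hs i.succ j.succ).ne'
      simp only [N, c, M, Matrix.submatrix_apply, Matrix.of_apply, Fin.succ_ne_zero, if_false]
      field_simp
      ring
    rw [← h1, h2, h3, Matrix.det_mul_column, Matrix.det_mul_row]
    have h4 := ih (fun i => x i.succ) (fun i => y i.succ)
      (fun a b h => hx (Fin.succ_lt_succ_iff.2 h)) (fun a b h => hy (Fin.succ_lt_succ_iff.2 h))
      (fun i => hx0 _) (fun i => hy0 _)
    have h5 : 0 < N 0 0 := by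
      simp only [N, c, M, Matrix.of_apply, if_true]
      have := hs 0 0
      simp only [zero_mul, add_zero]
      positivity
    refine mul_pos h5 (mul_pos (Finset.prod_pos fun i _ => ?_)
      (mul_pos (Finset.prod_pos fun i _ => ?_) h4))
    · exact div_pos (sub_pos.2 (hx (Fin.succ_pos i))) (hs _ _)
    · exact div_pos (sub_pos.2 (hy (Fin.succ_pos i))) (hs _ _)

/-- A fixed TP matrix. -/
noncomputable def acV (m n : ℕ) : Matrix (Fin m) (Fin n) ℝ :=
  Matrix.of fun i j => 1 / (((i : ℕ) + 1 : ℝ) + ((j : ℕ) + 1 : ℝ))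

lemma acV_pos {m n : ℕ} (i : Fin m) (j : Fin n) : 0 < acV m n i j := by
  simp only [acV, Matrix.of_apply]; positivity

lemma acV_TP (m n r : ℕ) (u : Fin m → ℝ) (v : Fin n → ℝ) (hu : ∀ i, 0 < u i)
    (hv : ∀ i, 0 < v i) : IsTPr (Matrix.of fun i j => u i * (v j * acV m n i j)) r := by
  intro k _ f g hf hg
  have h := ac_cauchy_pos k (fun i => ((f i : ℕ) + 1 : ℝ)) (fun i => ((g i : ℕ) + 1 : ℝ))
    (fun a b h => by have : (f a : ℕ) < f b := hf h
                     simpa using this)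
    (fun a b h => by have : (g a : ℕ) < g b := hg h
                     simpa using this)
    (fun i => by positivity) (fun i => by positivity)
  have e : (Matrix.of fun i j => u i * (v j * acV m n i j)).submatrix f g =
      Matrix.of fun i j : Fin k => u (f i) * (Matrix.of fun i j : Fin k => v (g j) *
       (Matrix.of fun i j : Fin k => 1 / (((f i : ℕ) + 1 : ℝ) + ((g j : ℕ) + 1 : ℝ))) i j) i j := by
    ext i j; simp [acV]
  rw [e, Matrix.det_mul_column, Matrix.det_mul_row]
  exact mul_pos (Finset.prod_pos fun i _ => hu _) (mul_pos (Finset.prod_pos fun i _ => hv _) h)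

lemma ac_two {m n : ℕ} {C : Matrix (Fin m) (Fin n) ℝ} (h : IsTNr C 2) {i i' : Fin m}
    {j j' : Fin n} (hi : i < i') (hj : j < j') : C i j' * C i' j ≤ C i j * C i' j' := by
  have := h 2 le_rfl ![i, i'] ![j, j']
    (by intro a b hab; fin_cases a <;> fin_cases b <;> simp_all)
    (by intro a b hab; fin_cases a <;> fin_cases b <;> simp_all)
  rw [Matrix.det_fin_two] at this
  simp at this
  linarith

lemma ac_one {m n : ℕ} {C : Matrix (Fin m) (Fin n) ℝ} (h : IsTNr C 2) (i : Fin m)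
    (j : Fin n) : 0 ≤ C i j := by
  have := h 1 (by norm_num) (fun _ => i) (fun _ => j)
    (by intro a b hab; exact absurd hab (by simp [Subsingleton.elim a b]))
    (by intro a b hab; exact absurd hab (by simp [Subsingleton.elim a b]))
  simpa using this

lemma ac_nonneg {m n : ℕ} {A : Matrix (Fin m) (Fin n) ℝ}
    (h : ∀ B : Matrix (Fin m) (Fin n) ℝ, IsTPr B (min m n) → IsTNr (A + B) 2)
    (i : Fin m) (j : Fin n) : 0 ≤ A i j := by
  by_contra hneg
  push Not at hneg
  have hV := acV_pos i j
  have := ac_one (h _ (acV_TP m n (min m n) (fun _ => -A i j / (2 * acV m n i j)) (fun _ => 1)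
    (fun _ => div_pos (by linarith) (by linarith)) (fun _ => one_pos))) i j
  simp only [Matrix.add_apply, Matrix.of_apply] at this
  have e : -A i j / (2 * acV m n i j) * (1 * acV m n i j) = -A i j / 2 := by
    field_simp
  rw [e] at this
  linarith

lemma ac_zero {m n : ℕ} {A : Matrix (Fin m) (Fin n) ℝ}
    (h : ∀ B : Matrix (Fin m) (Fin n) ℝ, IsTPr B (min m n) → IsTNr (A + B) 2)
    (p p' : Fin m) (q q' : Fin n) (ho : (p < p' ∧ q' < q) ∨ (p' < p ∧ q < q')) :
    A p q = 0 := by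
  by_contra hne
  have hA := ac_nonneg h
  have hpos : 0 < A p q := lt_of_le_of_ne (hA p q) (Ne.symm hne)
  have hp : p ≠ p' := by rcases ho with ⟨h, _⟩ | ⟨h, _⟩ <;> [exact h.ne; exact h.ne']
  have hq : q ≠ q' := by rcases ho with ⟨_, h⟩ | ⟨_, h⟩ <;> [exact h.ne'; exact h.ne]
  set R := (A p q' + acV m n p q') * (A p' q + acV m n p' q) with hR
  have hR0 : 0 ≤ R := mul_nonneg (add_nonneg (hA _ _) (acV_pos _ _).le)
    (add_nonneg (hA _ _) (acV_pos _ _).le)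
  set d := A p q * acV m n p' q' with hd
  have hd0 : 0 < d := mul_pos hpos (acV_pos _ _)
  set s : ℝ := R / d + 1 with hs
  have hs1 : 1 ≤ s := by have : 0 ≤ R / d := by positivity
                         linarith
  have hs0 : 0 < s := by linarith
  have hds : R < d * s := by
    rw [hs, mul_add, mul_div_cancel₀ _ hd0.ne']; linarith
  have hT := h _ (acV_TP m n (min m n) (fun i => if i = p' then s else s⁻¹)
    (fun j => if j = q' then s else s⁻¹)
    (fun i => by split_ifs <;> positivity)
    (fun i => by split_ifs <;> positivity))
  have key : ∀ C : Matrix (Fin m) (Fin n) ℝ, IsTNr C 2 → C p q * C p' q' ≤ C p q' * C p' q := by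
    intro C hC
    rcases ho with ⟨h1, h2⟩ | ⟨h1, h2⟩
    · exact ac_two hC h1 h2
    · have := ac_two hC h1 h2
      linarith
  have := key _ hT
  simp only [Matrix.add_apply, Matrix.of_apply, if_true, if_neg hp, if_neg hq,
    inv_mul_cancel_left₀ hs0.ne', mul_inv_cancel_left₀ hs0.ne', ← hR] at this
  have hV1 := acV_pos p q
  have hV2 := acV_pos p' q'
  have h1 : A p q ≤ A p q + s⁻¹ * (s⁻¹ * acV m n p q) := by
    have : 0 ≤ s⁻¹ * (s⁻¹ * acV m n p q) := by positivity
    linarith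
  have h2 : s * acV m n p' q' ≤ A p' q' + s * (s * acV m n p' q') := by
    have : s * acV m n p' q' ≤ s * (s * acV m n p' q') := by
      rw [← mul_assoc]
      exact mul_le_mul_of_nonneg_right (by nlinarith) hV2.le
    linarith [hA p' q']
  have h3 := mul_le_mul h1 h2 (by positivity) (by linarith)
  have : A p q * (s * acV m n p' q') = d * s := by rw [hd]; ring
  linarith

lemma ac_det0 {k : ℕ} (M : Matrix (Fin (k+1)) (Fin (k+1)) ℝ) (a : ℝ) :
    (Matrix.of fun i j => M i j + if i = 0 ∧ j = 0 then a else 0).det =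
      M.det + a * (M.submatrix Fin.succ Fin.succ).det := by
  rw [Matrix.det_succ_row_zero, Matrix.det_succ_row_zero M, Fin.sum_univ_succ, Fin.sum_univ_succ]
  have e : ∀ j : Fin (k+1), (Matrix.of fun i j => M i j + if i = 0 ∧ j = 0 then a else 0).submatrix
    Fin.succ j.succAbove = M.submatrix Fin.succ j.succAbove := by
    intro j; ext i l; simp [Fin.succ_ne_zero]
  simp only [e]
  simp [Fin.succ_ne_zero]
  ring

lemma ac_det1 {k : ℕ} (M : Matrix (Fin (k+1)) (Fin (k+1)) ℝ) (a : ℝ) :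
    (Matrix.of fun i j => M i j + if i = Fin.last k ∧ j = Fin.last k then a else 0).det =
      M.det + a * (M.submatrix Fin.castSucc Fin.castSucc).det := by
  rw [Matrix.det_succ_row _ (Fin.last k), Matrix.det_succ_row M (Fin.last k),
    Fin.sum_univ_castSucc, Fin.sum_univ_castSucc]
  have e : ∀ j : Fin (k+1), (Matrix.of fun i j => M i j +
      if i = Fin.last k ∧ j = Fin.last k then a else 0).submatrix
      (Fin.last k).succAbove j.succAbove = M.submatrix (Fin.last k).succAbove j.succAbove := by
    intro j; ext i l; simp [Fin.castSucc_ne_last]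
  simp only [e]
  simp [Fin.castSucc_ne_last]
  ring

/-- corner perturbations -/
def acC0 {m n : ℕ} (B : Matrix (Fin m) (Fin n) ℝ) (a : ℝ) : Matrix (Fin m) (Fin n) ℝ :=
  Matrix.of fun i j => B i j + if i.1 = 0 ∧ j.1 = 0 then a else 0

/-- corner perturbations -/
def acC1 {m n : ℕ} (B : Matrix (Fin m) (Fin n) ℝ) (a : ℝ) : Matrix (Fin m) (Fin n) ℝ :=
  Matrix.of fun i j => B i j + if i.1 = m - 1 ∧ j.1 = n - 1 then a else 0

lemma acC0_det {m n : ℕ} (B : Matrix (Fin m) (Fin n) ℝ) (a : ℝ) (k : ℕ) (f : Fin (k+1) → Fin m)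
    (g : Fin (k+1) → Fin n) (hf : StrictMono f) (hg : StrictMono g) :
    ((acC0 B a).submatrix f g).det = (B.submatrix f g).det ∨ ((acC0 B a).submatrix f g).det =
      (B.submatrix f g).det + a * (B.submatrix (f ∘ Fin.succ) (g ∘ Fin.succ)).det := by
  have lf : ∀ i, i ≠ 0 → (f i).1 ≠ 0 := fun i hi => by
    have : (f 0).1 < (f i).1 := hf (Fin.pos_iff_ne_zero.2 hi)
    omega
  have lg : ∀ i, i ≠ 0 → (g i).1 ≠ 0 := fun i hi => by
    have : (g 0).1 < (g i).1 := hg (Fin.pos_iff_ne_zero.2 hi)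
    omega
  by_cases h : (f 0).1 = 0 ∧ (g 0).1 = 0
  · right
    have := ac_det0 (B.submatrix f g) a
    rw [Matrix.submatrix_submatrix] at this
    rw [← this]
    congr 1
    ext i j
    simp only [acC0, Matrix.submatrix_apply, Matrix.of_apply]
    congr 1
    refine if_congr ⟨fun hh => ?_, fun hh => ?_⟩ rfl rfl
    · exact ⟨by_contra fun c => lf i c hh.1, by_contra fun c => lg j c hh.2⟩
    · rw [hh.1, hh.2]; exact h
  · left
    congr 1
    ext i j
    simp only [acC0, Matrix.submatrix_apply, Matrix.of_apply]
    rw [if_neg, add_zero]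
    rintro ⟨h1, h2⟩
    have hi : i = 0 := by_contra fun c => lf i c h1
    have hj : j = 0 := by_contra fun c => lg j c h2
    subst hi hj
    exact h ⟨h1, h2⟩

lemma acC1_det {m n : ℕ} (B : Matrix (Fin m) (Fin n) ℝ) (a : ℝ) (k : ℕ) (f : Fin (k+1) → Fin m)
    (g : Fin (k+1) → Fin n) (hf : StrictMono f) (hg : StrictMono g) :
    ((acC1 B a).submatrix f g).det = (B.submatrix f g).det ∨ ((acC1 B a).submatrix f g).det =
      (B.submatrix f g).det + a * (B.submatrix (f ∘ Fin.castSucc) (g ∘ Fin.castSucc)).det := by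
  have lf : ∀ i, i ≠ Fin.last k → (f i).1 ≠ m - 1 := fun i hi => by
    have : (f i).1 < (f (Fin.last k)).1 := hf (Fin.lt_last_iff_ne_last.2 hi)
    omega
  have lg : ∀ i, i ≠ Fin.last k → (g i).1 ≠ n - 1 := fun i hi => by
    have : (g i).1 < (g (Fin.last k)).1 := hg (Fin.lt_last_iff_ne_last.2 hi)
    omega
  by_cases h : (f (Fin.last k)).1 = m - 1 ∧ (g (Fin.last k)).1 = n - 1
  · right
    have := ac_det1 (B.submatrix f g) a
    rw [Matrix.submatrix_submatrix] at this
    rw [← this]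
    congr 1
    ext i j
    simp only [acC1, Matrix.submatrix_apply, Matrix.of_apply]
    congr 1
    refine if_congr ⟨fun hh => ?_, fun hh => ?_⟩ rfl rfl
    · exact ⟨by_contra fun c => lf i c hh.1, by_contra fun c => lg j c hh.2⟩
    · rw [hh.1, hh.2]; exact h
  · left
    congr 1
    ext i j
    simp only [acC1, Matrix.submatrix_apply, Matrix.of_apply]
    rw [if_neg, add_zero]
    rintro ⟨h1, h2⟩
    have hi : i = Fin.last k := by_contra fun c => lf i c h1
    have hj : j = Fin.last k := by_contra fun c => lg j c h2
    subst hi hj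
    exact h ⟨h1, h2⟩

lemma acC0_TN {m n r : ℕ} {B : Matrix (Fin m) (Fin n) ℝ} {a : ℝ} (ha : 0 ≤ a) (h : IsTNr B r) :
    IsTNr (acC0 B a) r := by
  intro k hk f g hf hg
  cases k with
  | zero => simp
  | succ k =>
    have h1 := h _ hk f g hf hg
    have h2 := h k (by omega) (f ∘ Fin.succ) (g ∘ Fin.succ)
      (hf.comp (Fin.strictMono_succ)) (hg.comp (Fin.strictMono_succ))
    rcases acC0_det B a k f g hf hg with e | e <;> rw [e] <;> positivity

lemma acC0_TP {m n r : ℕ} {B : Matrix (Fin m) (Fin n) ℝ} {a : ℝ} (ha : 0 ≤ a) (h : IsTPr B r) :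
    IsTPr (acC0 B a) r := by
  intro k hk f g hf hg
  cases k with
  | zero => simp
  | succ k =>
    have h1 := h _ hk f g hf hg
    have h2 := h k (by omega) (f ∘ Fin.succ) (g ∘ Fin.succ)
      (hf.comp (Fin.strictMono_succ)) (hg.comp (Fin.strictMono_succ))
    rcases acC0_det B a k f g hf hg with e | e <;> rw [e] <;> positivity

lemma acC1_TN {m n r : ℕ} {B : Matrix (Fin m) (Fin n) ℝ} {a : ℝ} (ha : 0 ≤ a) (h : IsTNr B r) :
    IsTNr (acC1 B a) r := by
  intro k hk f g hf hg
  cases k with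
  | zero => simp
  | succ k =>
    have h1 := h _ hk f g hf hg
    have h2 := h k (by omega) (f ∘ Fin.castSucc) (g ∘ Fin.castSucc)
      (hf.comp (Fin.strictMono_castSucc)) (hg.comp (Fin.strictMono_castSucc))
    rcases acC1_det B a k f g hf hg with e | e <;> rw [e] <;> positivity

lemma acC1_TP {m n r : ℕ} {B : Matrix (Fin m) (Fin n) ℝ} {a : ℝ} (ha : 0 ≤ a) (h : IsTPr B r) :
    IsTPr (acC1 B a) r := by
  intro k hk f g hf hg
  cases k with
  | zero => simp
  | succ k =>
    have h1 := h _ hk f g hf hg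
    have h2 := h k (by omega) (f ∘ Fin.castSucc) (g ∘ Fin.castSucc)
      (hf.comp (Fin.strictMono_castSucc)) (hg.comp (Fin.strictMono_castSucc))
    rcases acC1_det B a k f g hf hg with e | e <;> rw [e] <;> positivity

lemma ac_TN_mono {m n r s : ℕ} {B : Matrix (Fin m) (Fin n) ℝ} (hrs : s ≤ r) (h : IsTNr B r) :
    IsTNr B s := fun k hk => h k (hk.trans hrs)

lemma ac_TP_TN {m n r : ℕ} {B : Matrix (Fin m) (Fin n) ℝ} (h : IsTPr B r) :
    IsTNr B r := fun k hk f g hf hg => (h k hk f g hf hg).le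

/-- Theorem 3.6, "additive core". For an `m`-by-`n` real matrix `A`
and an integer `2 ≤ r ≤ min(m,n)`, the following are equivalent:
(a) `A + B` is TN whenever `B` is TN; (b) `A + B` is TP whenever `B` is TP;
(c) `A + B` is TN_r whenever `B` is TN_r; (d) `A + B` is TP_r whenever `B` is TP_r;
(e) `A + B` is TN_2 whenever `B` is TN; (f) `A + B` is TN_2 whenever `B` is TP;
(g) the upper-left and lower-right entries of `A` are nonnegative and all other
entries are zero. -/
theorem additive_core_tfae {m n : ℕ} (hm : 1 ≤ m) (hn : 1 ≤ n)
    (A : Matrix (Fin m) (Fin n) ℝ) (r : ℕ) (hr2 : 2 ≤ r) (hr : r ≤ min m n) :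
    List.TFAE
      [∀ B : Matrix (Fin m) (Fin n) ℝ, IsTNr B (min m n) → IsTNr (A + B) (min m n),
       ∀ B : Matrix (Fin m) (Fin n) ℝ, IsTPr B (min m n) → IsTPr (A + B) (min m n),
       ∀ B : Matrix (Fin m) (Fin n) ℝ, IsTNr B r → IsTNr (A + B) r,
       ∀ B : Matrix (Fin m) (Fin n) ℝ, IsTPr B r → IsTPr (A + B) r,
       ∀ B : Matrix (Fin m) (Fin n) ℝ, IsTNr B (min m n) → IsTNr (A + B) 2,
       ∀ B : Matrix (Fin m) (Fin n) ℝ, IsTPr B (min m n) → IsTNr (A + B) 2,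
       0 ≤ A ⟨0, hm⟩ ⟨0, hn⟩ ∧ 0 ≤ A ⟨m - 1, by omega⟩ ⟨n - 1, by omega⟩ ∧
         ∀ (i : Fin m) (j : Fin n), ¬(i.1 = 0 ∧ j.1 = 0) → ¬(i.1 = m - 1 ∧ j.1 = n - 1) →
           A i j = 0] := by
  have hm' : m - 1 < m := by omega
  have hn' : n - 1 < n := by omega
  have hm2 : 2 ≤ m := by omega
  have hn2 : 2 ≤ n := by omega
  have hdec : (0 ≤ A ⟨0, hm⟩ ⟨0, hn⟩ ∧ 0 ≤ A ⟨m - 1, by omega⟩ ⟨n - 1, by omega⟩ ∧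
         ∀ (i : Fin m) (j : Fin n), ¬(i.1 = 0 ∧ j.1 = 0) → ¬(i.1 = m - 1 ∧ j.1 = n - 1) →
           A i j = 0) → ∀ B, A + B = acC1 (acC0 B (A ⟨0, hm⟩ ⟨0, hn⟩))
             (A ⟨m - 1, by omega⟩ ⟨n - 1, by omega⟩) := by
    rintro ⟨_, _, h⟩ B
    ext i j
    simp only [acC1, acC0, Matrix.add_apply, Matrix.of_apply]
    by_cases h0 : i.1 = 0 ∧ j.1 = 0
    · have h1 : ¬(i.1 = m - 1 ∧ j.1 = n - 1) := by omega
      rw [if_pos h0, if_neg h1]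
      have hi : i = ⟨0, hm⟩ := Fin.ext h0.1
      have hj : j = ⟨0, hn⟩ := Fin.ext h0.2
      rw [hi, hj]; ring
    · by_cases h1 : i.1 = m - 1 ∧ j.1 = n - 1
      · rw [if_neg h0, if_pos h1]
        have hi : i = ⟨m - 1, hm'⟩ := Fin.ext h1.1
        have hj : j = ⟨n - 1, hn'⟩ := Fin.ext h1.2
        rw [hi, hj]; ring
      · rw [if_neg h0, if_neg h1, h i j h0 h1]; ring
  tfae_have 7 → 1 := fun h B hB => by
    rw [hdec h B]; exact acC1_TN h.2.1 (acC0_TN h.1 hB)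
  tfae_have 7 → 2 := fun h B hB => by
    rw [hdec h B]; exact acC1_TP h.2.1 (acC0_TP h.1 hB)
  tfae_have 7 → 3 := fun h B hB => by
    rw [hdec h B]; exact acC1_TN h.2.1 (acC0_TN h.1 hB)
  tfae_have 7 → 4 := fun h B hB => by
    rw [hdec h B]; exact acC1_TP h.2.1 (acC0_TP h.1 hB)
  tfae_have 1 → 5 := fun h B hB => ac_TN_mono (by omega) (h B hB)
  tfae_have 3 → 5 := fun h B hB => ac_TN_mono hr2 (h B (ac_TN_mono hr hB))
  tfae_have 2 → 6 := fun h B hB => ac_TN_mono (by omega) (ac_TP_TN (h B hB))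
  tfae_have 4 → 6 := fun h B hB =>
    ac_TN_mono hr2 (ac_TP_TN (h B (fun k hk => hB k (hk.trans hr))))
  tfae_have 5 → 6 := fun h B hB => h B (ac_TP_TN hB)
  tfae_have 6 → 7 := fun h => by
    refine ⟨ac_nonneg h _ _, ac_nonneg h _ _, fun i j h0 h1 => ?_⟩
    by_cases hc : i.1 < m - 1 ∧ 0 < j.1
    · exact ac_zero h i ⟨m - 1, by omega⟩ j ⟨0, by omega⟩ (Or.inl ⟨hc.1, hc.2⟩)
    · have h2 : 0 < i.1 := by omega
      have h3 : j.1 < n - 1 := by omega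
      exact ac_zero h i ⟨0, by omega⟩ j ⟨n - 1, by omega⟩ (Or.inr ⟨h2, h3⟩)
  tfae_finish
end

section
/- Let A and B be 3-by-3 symmetric real matrices. If A and B are both totally nonnegative (resp. totally positive), then the Hadamard product A ∘ B is totally nonnegative (resp. totally positive). -/
lemma had_core (a b c d e f a' b' c' d' e' f' : ℝ) :
    a ^ 3 * (a*a'*(d*d')*(f*f') - a*a'*(e*e')*(e*e') - b*b'*(b*b')*(f*f') + b*b'*(e*e')*(c*c')
      + c*c'*(b*b')*(e*e') - c*c'*(d*d')*(c*c'))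
    = (a*b*c)^2 * (a'*d'*f' - a'*e'*e' - b'*b'*f' + b'*e'*c' + c'*b'*e' - c'*d'*c')
      + a^2 * ((a*d-b*b)*d'*(c^2*(a'*f'-c'*c')) + (a*f-c*c)*f'*(b^2*(a'*d'-b'*b'))
          - 2*((a*e-b*c)*e'*(b*c*(a'*e'-b'*c'))))
      + a^2*a'*((a*d-b*b)*d'*((a*f-c*c)*f') - ((a*e-b*c)*e')^2) := by
  ring

/-- The part of the expansion which is nonnegative in both cases. -/
lemma had_rest (a b c d e f a' b' c' d' e' f' : ℝ)
    (ha : 0 ≤ a) (ha' : 0 ≤ a') (hd' : 0 ≤ d') (hf' : 0 ≤ f')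
    (hp : 0 ≤ a*d-b*b) (hr : 0 ≤ a*f-c*c)
    (hp' : 0 ≤ a'*d'-b'*b') (hr' : 0 ≤ a'*f'-c'*c') (hs' : 0 ≤ d'*f'-e'*e')
    (hD : 0 ≤ a*d*f - a*e*e - b*b*f + b*e*c + c*b*e - c*d*c)
    (hD' : 0 ≤ a'*d'*f' - a'*e'*e' - b'*b'*f' + b'*e'*c' + c'*b'*e' - c'*d'*c') :
    0 ≤ a^2 * ((a*d-b*b)*d'*(c^2*(a'*f'-c'*c')) + (a*f-c*c)*f'*(b^2*(a'*d'-b'*b'))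
          - 2*((a*e-b*c)*e'*(b*c*(a'*e'-b'*c'))))
      + a^2*a'*((a*d-b*b)*d'*((a*f-c*c)*f') - ((a*e-b*c)*e')^2) := by
  have h1 : (a*e-b*c)^2 ≤ (a*d-b*b)*(a*f-c*c) := by nlinarith [mul_nonneg ha hD]
  have h1' : (a'*e'-b'*c')^2 ≤ (a'*d'-b'*b')*(a'*f'-c'*c') := by nlinarith [mul_nonneg ha' hD']
  have h2' : e'^2 ≤ d'*f' := by nlinarith
  generalize a*d-b*b = p at *
  generalize a*f-c*c = r at *
  generalize a*e-b*c = q at *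
  generalize a'*d'-b'*b' = p' at *
  generalize a'*f'-c'*c' = r' at *
  generalize a'*e'-b'*c' = q' at *
  have h3 : q^2*e'^2 ≤ (p*r)*(d'*f') := by gcongr
  have h4 : (q^2*e'^2)*q'^2 ≤ (p*r)*(d'*f')*(p'*r') := by gcongr
  have h5 : (2*(q*e'*(b*c*q')))^2 ≤ (p*d'*(c^2*r') + r*f'*(b^2*p'))^2 := by
    nlinarith [mul_le_mul_of_nonneg_left h4 (sq_nonneg (b*c)),
      sq_nonneg (p*d'*(c^2*r') - r*f'*(b^2*p'))]
  have h6 := abs_le_of_sq_le_sq' h5 (by positivity)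
  have h7 : 0 ≤ p*d'*(r*f') - (q*e')^2 := by nlinarith
  have h8 : 0 ≤ p*d'*(c^2*r') + r*f'*(b^2*p') - 2*(q*e'*(b*c*q')) := by linarith [h6.2]
  positivity

lemma strictMono_fin3 (f : Fin 3 → Fin 3) (hf : StrictMono f) : f = id := by
  have h1 : f 0 < f 1 := hf (by decide)
  have h2 : f 1 < f 2 := hf (by decide)
  funext i
  fin_cases i <;> simp <;> omega

lemma sm2 (i j : Fin 3) (h : i < j) : StrictMono ![i, j] := by
  intro x y hxy
  fin_cases x <;> fin_cases y <;> simp_all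

theorem hadamard_product_3x3_symm (A B : Matrix (Fin 3) (Fin 3) ℝ)
    (hA : A.IsSymm) (hB : B.IsSymm) :
    (IsTNr A 3 → IsTNr B 3 → IsTNr (Matrix.hadamard A B) 3) ∧
    (IsTPr A 3 → IsTPr B 3 → IsTPr (Matrix.hadamard A B) 3) := by
  have a10 := hA.apply 0 1
  have a20 := hA.apply 0 2
  have a21 := hA.apply 1 2
  have b10 := hB.apply 0 1
  have b20 := hB.apply 0 2
  have b21 := hB.apply 1 2
  have key (M : Matrix (Fin 3) (Fin 3) ℝ) (hM : M.IsSymm) (h : IsTNr M 3) :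
      (∀ i j, 0 ≤ M i j) ∧ 0 ≤ M 0 0 * M 1 1 - M 0 1 * M 0 1 ∧
      0 ≤ M 0 0 * M 2 2 - M 0 2 * M 0 2 ∧ 0 ≤ M 1 1 * M 2 2 - M 1 2 * M 1 2 ∧
      0 ≤ M.det := by
    have two (i j : Fin 3) (hij : i < j) : 0 ≤ M i i * M j j - M i j * M i j := by
      have := h 2 (by norm_num) ![i, j] ![i, j] (sm2 _ _ hij) (sm2 _ _ hij)
      rw [Matrix.det_fin_two] at this
      have e := hM.apply i j
      simpa [e] using this
    refine ⟨fun i j => ?_, ?_, ?_, ?_, ?_⟩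
    · simpa using h 1 (by norm_num) (fun _ => i) (fun _ => j)
        (Subsingleton.strictMono _) (Subsingleton.strictMono _)
    · exact two 0 1 (by decide)
    · exact two 0 2 (by decide)
    · exact two 1 2 (by decide)
    · simpa using h 3 le_rfl id id strictMono_id strictMono_id
  constructor
  · intro h h' k hk f g hf hg
    obtain ⟨nA, pA, rA, sA, dA⟩ := key A hA h
    obtain ⟨nB, pB, rB, sB, dB⟩ := key B hB h'
    obtain rfl | rfl | rfl | rfl : k = 0 ∨ k = 1 ∨ k = 2 ∨ k = 3 := by omega
    · simp
    · simpa using mul_nonneg (nA _ _) (nB _ _)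
    · have u := h 2 hk f g hf hg
      have v := h' 2 hk f g hf hg
      simp only [Matrix.det_fin_two, Matrix.submatrix_apply, Matrix.hadamard_apply] at *
      have := mul_le_mul (sub_nonneg.1 u) (sub_nonneg.1 v)
        (mul_nonneg (nB _ _) (nB _ _)) (mul_nonneg (nA _ _) (nA _ _))
      linarith
    · rw [strictMono_fin3 f hf, strictMono_fin3 g hg]
      simp only [Matrix.submatrix_id_id, Matrix.det_fin_three, Matrix.hadamard_apply,
        a10, a20, a21, b10, b20, b21] at *
      have rest := had_rest _ _ _ _ _ _ _ _ _ _ _ _ (nA 0 0) (nB 0 0) (nB 1 1) (nB 2 2)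
        pA rA pB rB sB dA dB
      have core := had_core (A 0 0) (A 0 1) (A 0 2) (A 1 1) (A 1 2) (A 2 2)
        (B 0 0) (B 0 1) (B 0 2) (B 1 1) (B 1 2) (B 2 2)
      rcases (nA 0 0).eq_or_lt with h0 | h0
      · have hb : A 0 1 = 0 := by rw [← h0] at pA; nlinarith
        have hc : A 0 2 = 0 := by rw [← h0] at rA; nlinarith
        simp [← h0, hb, hc]
      · have := mul_nonneg (sq_nonneg (A 0 0 * A 0 1 * A 0 2)) dB
        exact nonneg_of_mul_nonneg_right (by rw [core]; linarith) (pow_pos h0 3)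
  · intro h h' k hk f g hf hg
    obtain ⟨nA, pA, rA, sA, dA⟩ := key A hA fun k hk f g hf hg => (h k hk f g hf hg).le
    obtain ⟨nB, pB, rB, sB, dB⟩ := key B hB fun k hk f g hf hg => (h' k hk f g hf hg).le
    have qA (i j) : 0 < A i j := by
      simpa using h 1 (by norm_num) (fun _ => i) (fun _ => j)
        (Subsingleton.strictMono _) (Subsingleton.strictMono _)
    have qB (i j) : 0 < B i j := by
      simpa using h' 1 (by norm_num) (fun _ => i) (fun _ => j)
        (Subsingleton.strictMono _) (Subsingleton.strictMono _)
    have dB' : 0 < B.det := by simpa using h' 3 le_rfl id id strictMono_id strictMono_id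
    obtain rfl | rfl | rfl | rfl : k = 0 ∨ k = 1 ∨ k = 2 ∨ k = 3 := by omega
    · simp
    · simpa using mul_pos (qA _ _) (qB _ _)
    · have u := h 2 hk f g hf hg
      have v := h' 2 hk f g hf hg
      simp only [Matrix.det_fin_two, Matrix.submatrix_apply, Matrix.hadamard_apply] at *
      have := mul_lt_mul (sub_pos.1 u) (sub_pos.1 v).le
        (mul_pos (qB _ _) (qB _ _)) (mul_nonneg (nA _ _) (nA _ _))
      linarith
    · rw [strictMono_fin3 f hf, strictMono_fin3 g hg]
      simp only [Matrix.submatrix_id_id, Matrix.det_fin_three, Matrix.hadamard_apply,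
        a10, a20, a21, b10, b20, b21] at *
      have rest := had_rest _ _ _ _ _ _ _ _ _ _ _ _ (nA 0 0) (nB 0 0) (nB 1 1) (nB 2 2)
        pA rA pB rB sB dA dB
      have core := had_core (A 0 0) (A 0 1) (A 0 2) (A 1 1) (A 1 2) (A 2 2)
        (B 0 0) (B 0 1) (B 0 2) (B 1 1) (B 1 2) (B 2 2)
      have := mul_pos (pow_pos (mul_pos (mul_pos (qA 0 0) (qA 0 1)) (qA 0 2)) 2) dB'
      exact pos_of_mul_pos_right (by rw [core]; linarith) (pow_pos (qA 0 0) 3).le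
end

section
/- Let A and B be n-by-n Hankel matrices of real numbers. (a) If A and B are both TN_r, then the Hadamard product A ∘ B is TN_r. (b) If A and B are both TP_r, then A ∘ B is TP_r. -/
/-- full-size model of the principal minor on `S` -/
noncomputable def pmat {ι : Type*} [DecidableEq ι] (M : Matrix ι ι ℝ) (S : Finset ι) : Matrix ι ι ℝ :=
  Matrix.of fun a b => if a ∈ S then M a b else (if a = b then 1 else 0)

theorem pmat_det {ι : Type*} [DecidableEq ι] [Fintype ι] (M : Matrix ι ι ℝ) (S : Finset ι) :
    (pmat M S).det = (M.submatrix (fun a : {a // a ∈ S} => a.1) (fun a => a.1)).det := by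
  rw [Matrix.twoBlockTriangular_det (pmat M S) (fun a => a ∈ S)]
  · have h1 : (pmat M S).toSquareBlockProp (fun i => ¬ i ∈ S) = 1 := by
      ext ⟨i, hi⟩ ⟨j, hj⟩
      simp [pmat, Matrix.toSquareBlockProp, hi, Matrix.one_apply]
    have h2 : (pmat M S).toSquareBlockProp (fun i => i ∈ S)
        = (M.submatrix (fun a : {a // a ∈ S} => a.1) (fun a => a.1)) := by
      ext ⟨i, hi⟩ ⟨j, hj⟩
      simp [pmat, Matrix.toSquareBlockProp, hi]
    rw [h1, h2, Matrix.det_one, mul_one]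
    congr!
  · intro i hi j hj
    have : i ≠ j := by rintro rfl; exact hi hj
    simp [pmat, hi, this]

theorem pmat_add {ι : Type*} [DecidableEq ι] [Fintype ι] (M : Matrix ι ι ℝ) (d : ι → ℝ)
    (hd : ∀ i, 0 ≤ d i) (hM : ∀ S, 0 ≤ (pmat M S).det) (T : Finset ι) :
    ∀ S, ∏ i ∈ S, (if i ∈ T then d i else 0) ≤
      (pmat (M + Matrix.diagonal (fun i => if i ∈ T then d i else 0)) S).det := by
  induction T using Finset.induction_on with
  | empty =>
    intro S
    rcases S.eq_empty_or_nonempty with rfl | ⟨i, hi⟩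
    · have : pmat (M + Matrix.diagonal (fun i => if i ∈ (∅ : Finset ι) then d i else 0)) ∅ = 1 := by
        ext i j; simp [pmat, Matrix.one_apply]
      rw [this]; simp
    · rw [Finset.prod_eq_zero hi (by simp)]
      simpa using hM S
  | insert t T ht ih =>
    intro S
    set N := M + Matrix.diagonal (fun i => if i ∈ T then d i else 0) with hN
    have hN' : M + Matrix.diagonal (fun i => if i ∈ insert t T then d i else 0)
        = N + Matrix.single t t (d t) := by
      ext i j
      simp only [hN, Matrix.add_apply, Matrix.diagonal_apply, Matrix.single_apply,
        Finset.mem_insert]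
      by_cases h : i = j <;> by_cases h2 : i = t <;> grind
    rw [hN']
    have hnn : ∀ S, 0 ≤ (pmat N S).det := fun S => le_trans
      (Finset.prod_nonneg fun i _ => by split_ifs <;> simp [hd]) (ih S)
    by_cases hS : t ∈ S
    · have key : (pmat (N + Matrix.single t t (d t)) S).det
          = (pmat N S).det + d t * (pmat N (S.erase t)).det := by
        have e1 : pmat (N + Matrix.single t t (d t)) S
            = (pmat N S).updateRow t (pmat N S t + d t • Pi.single t 1) := by
          ext i j
          by_cases h : i = t
          · subst h
            by_cases h : i = j
            · subst h; simp [pmat, hS]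
            · simp [pmat, hS, Matrix.single_apply, h]
          · have h' : t ≠ i := fun e => h e.symm
            simp [pmat, Matrix.updateRow_ne h, Matrix.single_apply, h']
        have e2 : (pmat N S).updateRow t (Pi.single t 1) = pmat N (S.erase t) := by
          ext i j
          by_cases h : i = t
          · subst h; simp [pmat, Pi.single_apply, eq_comm]
          · simp [pmat, h]
        rw [e1, Matrix.det_updateRow_add, Matrix.det_updateRow_smul, e2, Matrix.updateRow_eq_self]
      rw [key, ← Finset.mul_prod_erase S _ hS]
      have e3 : ∏ x ∈ S.erase t, (if x ∈ insert t T then d x else 0)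
          = ∏ x ∈ S.erase t, (if x ∈ T then d x else 0) := by
        apply Finset.prod_congr rfl
        intro x hx
        simp [Finset.ne_of_mem_erase hx]
      rw [e3]
      have := mul_le_mul_of_nonneg_left (ih (S.erase t)) (hd t)
      have := hnn S
      simp only [Finset.mem_insert, true_or, if_true]
      linarith
    · have e1 : pmat (N + Matrix.single t t (d t)) S = pmat N S := by
        ext i j
        by_cases h : i ∈ S
        · have : t ≠ i := by rintro rfl; exact hS h
          simp [pmat, Matrix.single_apply, this]
        · simp [pmat, h]
      have e3 : ∏ x ∈ S, (if x ∈ insert t T then d x else 0)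
          = ∏ x ∈ S, (if x ∈ T then d x else 0) := by
        apply Finset.prod_congr rfl
        intro x hx
        have : x ≠ t := by rintro rfl; exact hS hx
        simp [this]
      rw [e1, e3]; exact ih S

theorem posSemidef_of_minors {k : ℕ} (M : Matrix (Fin k) (Fin k) ℝ) (hs : ∀ i j, M i j = M j i)
    (hM : ∀ (l : ℕ) (f : Fin l → Fin k), StrictMono f → 0 ≤ (M.submatrix f f).det) :
    M.PosSemidef := by
  have hH : M.IsHermitian := by ext i j; simp [hs i j]
  have hP : ∀ S, 0 ≤ (pmat M S).det := by
    intro S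
    rw [pmat_det]
    have := hM S.card (S.orderEmbOfFin rfl) (S.orderEmbOfFin rfl).strictMono
    rw [← Matrix.det_submatrix_equiv_self (S.orderIsoOfFin rfl).toEquiv]
    exact this
  rw [hH.posSemidef_iff_eigenvalues_nonneg]
  intro i
  by_contra hlt
  simp only [Pi.zero_apply, not_le] at hlt
  set c := hH.eigenvalues i with hc
  have h1 := pmat_add M (fun _ => -c) (fun _ => by linarith) hP Finset.univ Finset.univ
  have e : pmat (M + Matrix.diagonal (fun i => if i ∈ (Finset.univ : Finset (Fin k)) then -c else 0))
      Finset.univ = M + Matrix.diagonal (fun _ => -c) := by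
    ext i j; simp [pmat]
  rw [e] at h1
  have h2 : 0 < ∏ i ∈ (Finset.univ : Finset (Fin k)),
      (if i ∈ (Finset.univ : Finset (Fin k)) then -c else 0) :=
    Finset.prod_pos fun i _ => by simpa using hlt
  have h3 : (M + Matrix.diagonal (fun _ => -c)).det = 0 := by
    rw [← Matrix.exists_mulVec_eq_zero_iff]
    refine ⟨⇑(hH.eigenvectorBasis i), ?_, ?_⟩
    · intro h0
      apply hH.eigenvectorBasis.orthonormal.ne_zero i
      ext j; exact congrFun h0 j
    · rw [Matrix.add_mulVec, hH.mulVec_eigenvectorBasis]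
      ext j
      simp [hc]
  linarith

/-- the key three-term relation -/
theorem plucker3 {m : ℕ} (V : Fin (m+3) → Fin (m+2) → ℝ) (q : Fin (m+1)) :
    let ω : Fin m → Fin (m+3) := fun i => (q.succAbove i).castSucc.succ
    let E : Fin (m+1) → Fin (m+3) → ℝ := fun p x =>
      (Matrix.of fun (i j : Fin (m+1)) =>
        V ((p.insertNth x ω : Fin (m+1) → Fin (m+3)) i) j.castSucc).det
    let D : Fin (m+3) → ℝ := fun x => (Matrix.of fun i j : Fin (m+2) => V (x.succAbove i) j).det
    D q.castSucc.succ * E q q.castSucc.succ =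
      D 0 * E 0 0 + D (Fin.last _) * E (Fin.last _) (Fin.last _) := by
  intro ω E D
  let φ : Fin (m+3) → ℝ := fun x => ∑ j : Fin (m+1), (-1)^(j:ℕ) * V x j.castSucc *
    (Matrix.of fun (i l : Fin m) => V (ω i) (j.succAbove l).castSucc).det
  have hE : ∀ p x, E p x = (-1)^(p:ℕ) * φ x := by
    intro p x
    simp only [E, φ]
    rw [Matrix.det_succ_row _ p, Finset.mul_sum]
    refine Finset.sum_congr rfl fun j _ => ?_
    rw [pow_add]
    have : ((Matrix.of fun (i j : Fin (m+1)) =>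
        V ((p.insertNth x ω : Fin (m+1) → Fin (m+3)) i) j.castSucc).submatrix p.succAbove j.succAbove)
        = (Matrix.of fun (i l : Fin m) => V (ω i) (j.succAbove l).castSucc) := by
      ext i l; simp
    rw [this]
    simp only [Matrix.of_apply, Fin.insertNth_apply_same]
    ring
  have hrel : ∀ c : Fin (m+2), ∑ i : Fin (m+3), (-1)^(i:ℕ) * V i c * D i = 0 := by
    intro c
    have h0 : (Matrix.of fun (i j : Fin (m+3)) => V i ((Fin.cons c id : Fin (m+3) → Fin (m+2)) j)).det = 0 := by
      apply Matrix.det_zero_of_column_eq (i := 0) (j := c.succ) (Fin.succ_ne_zero c).symm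
      intro i; simp
    rw [Matrix.det_succ_column_zero] at h0
    rw [← h0]
    refine Finset.sum_congr rfl fun i _ => ?_
    simp only [Matrix.of_apply, Fin.cons_zero]
    congr 2
  have hsum : ∑ i : Fin (m+3), (-1)^(i:ℕ) * φ i * D i = 0 := by
    have : ∀ i : Fin (m+3), (-1)^(i:ℕ) * φ i * D i = ∑ j : Fin (m+1),
      ((-1)^(j:ℕ) * (Matrix.of fun (i l : Fin m) => V (ω i) (j.succAbove l).castSucc).det) *
       ((-1)^(i:ℕ) * V i j.castSucc * D i) := by
      intro i
      simp only [φ]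
      rw [Finset.mul_sum, Finset.sum_mul]
      refine Finset.sum_congr rfl fun j _ => ?_
      ring
    simp_rw [this]
    rw [Finset.sum_comm]
    simp_rw [← Finset.mul_sum, hrel]
    simp
  have hz : ∀ i, φ (ω i) = 0 := by
    intro i
    have h := hE 0 (ω i)
    have h2 : E 0 (ω i) = 0 := by
      apply Matrix.det_zero_of_row_eq (i := 0) (j := i.succ) (Fin.succ_ne_zero i).symm
      ext j; simp
    rw [h2] at h
    simpa using h.symm
  rw [Fin.sum_univ_succ, Fin.sum_univ_castSucc, Fin.sum_univ_succAbove _ q] at hsum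
  have hz2 : ∑ i : Fin m, (-1 : ℝ)^(((q.succAbove i).castSucc.succ : Fin (m+3)) : ℕ) *
      φ (q.succAbove i).castSucc.succ * D (q.succAbove i).castSucc.succ = 0 := by
    apply Finset.sum_eq_zero
    intro i _
    have := hz i
    simp only [ω] at this
    rw [this]; simp
  rw [hz2] at hsum
  rw [hE, hE, hE]
  have hl : (Fin.last (m+1)).succ = Fin.last (m+2) := rfl
  rw [hl] at hsum
  simp only [Fin.val_zero, Fin.val_succ, Fin.val_castSucc, Fin.val_last, pow_succ, pow_zero] at hsum ⊢
  linear_combination -hsum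

theorem row_step {m n : ℕ} (N : ℕ → Fin (m+2) → ℝ)
    (H1 : ∀ f : Fin (m+1) → ℕ, StrictMono f → (∀ i, f i < n) →
      0 < (Matrix.of fun i j : Fin (m+1) => N (f i) j.castSucc).det)
    (H2 : ∀ a, a + (m+2) ≤ n → 0 < (Matrix.of fun i j : Fin (m+2) => N (a + i) j).det) :
    ∀ (d : ℕ) (f : Fin (m+2) → ℕ), StrictMono f → (∀ i, f i < n) → f (Fin.last _) ≤ f 0 + d →
      0 < (Matrix.of fun i j : Fin (m+2) => N (f i) j).det := by
  intro d
  induction d with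
  | zero =>
    intro f hf _ hd
    have := hf (show (0 : Fin (m+2)) < Fin.last _ from Fin.last_pos)
    omega
  | succ d ih =>
    intro f hf hn hd
    by_cases hgap : ∃ i : Fin (m+1), f i.castSucc + 1 < f i.succ
    · obtain ⟨q, hq⟩ := hgap
      set G : Fin (m+3) → ℕ := Fin.insertNth q.castSucc.succ (f q.castSucc + 1) f with hG
      have hGm : StrictMono G := Fin.strictMono_insertNth hf q _ (by omega) hq
      have hGf : ∀ i, G (q.castSucc.succ.succAbove i) = f i := by
        intro i; simp [hG]
      have hG0 : G 0 = f 0 := by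
        rw [← hGf 0]; congr 1
      have hGl : G (Fin.last _) = f (Fin.last _) := by
        rw [← hGf (Fin.last _)]; congr 1
        rw [Fin.succAbove_of_le_castSucc]
        · rfl
        · rw [Fin.le_def]; simp; omega
      have hGn : ∀ i, G i < n := by
        intro i
        have := hGm.monotone (Fin.le_last i)
        rw [hGl] at this
        exact lt_of_le_of_lt this (hn _)
      have key := plucker3 (fun i => N (G i)) q
      simp only at key
      set ω : Fin m → Fin (m+3) := fun i => (q.succAbove i).castSucc.succ with hω
      have hωm : StrictMono ω := by
        intro i j hij
        simp only [hω, Fin.succ_lt_succ_iff, Fin.castSucc_lt_castSucc_iff]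
        exact Fin.strictMono_succAbove q hij
      have E0 : StrictMono (Fin.insertNth 0 0 ω : Fin (m+1) → Fin (m+3)) := by
        rw [Fin.insertNth_zero']
        intro i j
        refine Fin.cases ?_ (fun i => ?_) i <;> refine Fin.cases ?_ (fun j => ?_) j
        · simp
        · intro _; simp only [Fin.cons_zero, Fin.cons_succ]; exact Fin.succ_pos _
        · simp
        · simpa using fun h => hωm h
      have El : StrictMono (Fin.insertNth (Fin.last _) (Fin.last _) ω : Fin (m+1) → Fin (m+3)) := by
        rw [Fin.insertNth_last']
        intro i j
        refine Fin.lastCases ?_ (fun i => ?_) i <;> refine Fin.lastCases ?_ (fun j => ?_) j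
        · simp
        · intro h; exact absurd h (not_lt.2 (Fin.le_last _))
        · intro _; simp only [Fin.snoc_last, Fin.snoc_castSucc]
          simp only [hω, Fin.lt_def]; simp; omega
        · simpa using fun h => hωm h
      have Eq : StrictMono (Fin.insertNth q q.castSucc.succ ω : Fin (m+1) → Fin (m+3)) := by
        have : (Fin.insertNth q q.castSucc.succ ω : Fin (m+1) → Fin (m+3))
            = fun i => i.castSucc.succ := by
          ext i
          rcases Fin.eq_self_or_eq_succAbove q i with rfl | ⟨j, rfl⟩
          · simp
          · simp [hω]
        rw [this]
        intro i j h; simpa using h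
      have P0 := H1 (fun i => G ((Fin.insertNth 0 0 ω : Fin (m+1) → Fin (m+3)) i))
        (hGm.comp E0) (fun _ => hGn _)
      have Pl := H1 (fun i => G ((Fin.insertNth (Fin.last _) (Fin.last _) ω : Fin (m+1) → Fin (m+3)) i))
        (hGm.comp El) (fun _ => hGn _)
      have Pq := H1 (fun i => G ((Fin.insertNth q q.castSucc.succ ω : Fin (m+1) → Fin (m+3)) i))
        (hGm.comp Eq) (fun _ => hGn _)
      have D0 := ih (fun i => G ((0 : Fin (m+3)).succAbove i))
        (hGm.comp (Fin.strictMono_succAbove _)) (fun _ => hGn _) (by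
          have h1 : G 0 < G ((0 : Fin (m+3)).succAbove 0) := hGm (by simp)
          have h2 : G ((0 : Fin (m+3)).succAbove (Fin.last _)) ≤ G (Fin.last _) :=
            hGm.monotone (Fin.le_last _)
          omega)
      have Dl := ih (fun i => G ((Fin.last _ : Fin (m+3)).succAbove i))
        (hGm.comp (Fin.strictMono_succAbove _)) (fun _ => hGn _) (by
          have h1 : G ((Fin.last _ : Fin (m+3)).succAbove 0) = G 0 := by
            rw [Fin.succAbove_last_apply]; rfl
          have h2 : G ((Fin.last _ : Fin (m+3)).succAbove (Fin.last _)) < G (Fin.last _) :=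
            hGm (by rw [Fin.succAbove_last_apply]; exact Fin.castSucc_lt_last _)
          omega)
      simp only [hGf] at key
      have hpos := add_pos (mul_pos D0 P0) (mul_pos Dl Pl)
      rw [← key] at hpos
      exact pos_of_mul_pos_left hpos Pq.le
    · push Not at hgap
      have hc : ∀ i : Fin (m+2), f i = f 0 + i := by
        intro i
        induction i using Fin.induction with
        | zero => simp
        | succ i ih =>
          have h1 := hgap i
          have h2 := hf (Fin.castSucc_lt_succ (i := i))
          simp only [Fin.val_castSucc, Fin.val_succ] at *
          omega
      have := H2 (f 0) (by
        have h1 := hn (Fin.last _)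
        rw [hc] at h1
        simp at h1; omega)
      simp_rw [← hc] at this
      exact this

theorem fekete_nat {n r : ℕ} (M : ℕ → ℕ → ℝ)
    (H : ∀ k, k ≤ r → ∀ a b, a + k ≤ n → b + k ≤ n →
      0 < (Matrix.of fun i j : Fin k => M (a + i) (b + j)).det) :
    ∀ k, k ≤ r → ∀ (f g : Fin k → ℕ), StrictMono f → StrictMono g → (∀ i, f i < n) →
      (∀ i, g i < n) → 0 < (Matrix.of fun i j : Fin k => M (f i) (g j)).det := by
  intro k
  induction k with
  | zero => intros; simp
  | succ k ih =>
    intro hk f g hf hg hfn hgn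
    rcases k with _ | m
    · have := H 1 hk (f 0) (g 0) (hfn 0) (hgn 0)
      simpa using this
    · have step : ∀ b, b + (m+2) ≤ n → ∀ f : Fin (m+2) → ℕ, StrictMono f → (∀ i, f i < n) →
          0 < (Matrix.of fun i j : Fin (m+2) => M (f i) (b + j)).det := by
        intro b hb f hf hfn
        refine row_step (n := n) (fun x (j : Fin (m+2)) => M x (b + j)) ?_ ?_ (f (Fin.last _)) f hf hfn
          (by omega)
        · intro f' hf' hfn'
          exact ih (by omega) f' (fun j => b + j) hf' (fun i j h => by simpa using h) hfn'
            (fun i => by omega)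
        · intro a ha
          exact H (m+2) hk a b ha hb
      rw [← Matrix.det_transpose]
      refine row_step (n := n) (fun x (j : Fin (m+2)) => M (f j) x) ?_ ?_ (g (Fin.last _)) g hg hgn
          (by omega)
      · intro g' hg' hgn'
        rw [← Matrix.det_transpose]
        exact ih (by omega) (fun j => f j.castSucc) g'
          (hf.comp (Fin.strictMono_castSucc)) hg' (fun _ => hfn _) hgn'
      · intro b hb
        rw [← Matrix.det_transpose]
        exact step b hb f hf hfn

theorem fekete {n r : ℕ} (A : Matrix (Fin n) (Fin n) ℝ)
    (H : ∀ k, k ≤ r → ∀ a b (ha : a + k ≤ n) (hb : b + k ≤ n), 0 < (ctgSub A k a b ha hb).det) :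
    IsTPr A r := by
  intro k hk f g hf hg
  have := fekete_nat (n := n) (r := r)
    (fun i j => if h : i < n ∧ j < n then A ⟨i, h.1⟩ ⟨j, h.2⟩ else 0) (by
      intro k hk a b ha hb
      convert H k hk a b ha hb using 2
      ext i j
      have h1 : a + (i : ℕ) < n := by omega
      have h2 : b + (j : ℕ) < n := by omega
      simp [ctgSub, h1, h2]) k hk (fun i => f i) (fun i => g i) (fun i j h => hf h)
      (fun i j h => hg h) (fun i => (f i).2) (fun i => (g i).2)
  convert this using 2
  ext i j
  simp

theorem ctg_posSemidef {n r : ℕ} (A : Matrix (Fin n) (Fin n) ℝ) (hH : IsHankel A) (hA : IsTNr A r)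
    (k : ℕ) (hk : k ≤ r) (a b : ℕ) (ha : a + k ≤ n) (hb : b + k ≤ n) :
    (ctgSub A k a b ha hb).PosSemidef := by
  apply posSemidef_of_minors
  · intro i j
    simp only [ctgSub, Matrix.of_apply]
    apply hH
    simp only
    omega
  · intro l f hf
    have hl : l ≤ k := by simpa using Fintype.card_le_of_injective f hf.injective
    exact hA l (hl.trans hk) (fun i => ⟨a + f i, by omega⟩) (fun i => ⟨b + f i, by omega⟩)
      (fun i j h => by simpa using hf h) (fun i j h => by simpa using hf h)

theorem IsTPr.toTNr {n r : ℕ} {A : Matrix (Fin n) (Fin n) ℝ} (hA : IsTPr A r) : IsTNr A r :=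
  fun k hk f g hf hg => (hA k hk f g hf hg).le

theorem ctg_posDef {n r : ℕ} (A : Matrix (Fin n) (Fin n) ℝ) (hH : IsHankel A) (hA : IsTPr A r)
    (k : ℕ) (hk : k ≤ r) (a b : ℕ) (ha : a + k ≤ n) (hb : b + k ≤ n) :
    (ctgSub A k a b ha hb).PosDef := by
  rw [(ctg_posSemidef A hH hA.toTNr k hk a b ha hb).posDef_iff_det_ne_zero]
  refine ne_of_gt (hA k hk (fun i => ⟨a + i, by omega⟩) (fun i => ⟨b + i, by omega⟩)
    (fun i j h => by simpa using h) (fun i j h => by simpa using h))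

theorem hadamard_core {n r : ℕ} (A B : Matrix (Fin n) (Fin n) ℝ)
    (hA : ∀ k, k ≤ r → ∀ a b (ha : a + k ≤ n) (hb : b + k ≤ n), (ctgSub A k a b ha hb).PosDef)
    (hB : ∀ k, k ≤ r → ∀ a b (ha : a + k ≤ n) (hb : b + k ≤ n), (ctgSub B k a b ha hb).PosDef) :
    IsTPr (Matrix.hadamard A B) r := by
  apply fekete
  intro k hk a b ha hb
  exact ((hA k hk a b ha hb).hadamard (hB k hk a b ha hb)).det_pos

/-- A Hankel matrix all of whose contiguous blocks are positive definite. -/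
noncomputable def momMat (n : ℕ) : Matrix (Fin n) (Fin n) ℝ :=
  Matrix.of fun i j => ∑ t : Fin n, ((t : ℝ) + 1) ^ ((i : ℕ) + (j : ℕ))

theorem momMat_posDef {n : ℕ} (k a b : ℕ) (ha : a + k ≤ n) (hb : b + k ≤ n) :
    (ctgSub (momMat n) k a b ha hb).PosDef := by
  let V : Matrix (Fin n) (Fin k) ℝ := Matrix.of fun t i => ((t : ℝ) + 1) ^ (i : ℕ)
  have e : ctgSub (momMat n) k a b ha hb
      = V.conjTranspose * Matrix.diagonal (fun t : Fin n => ((t : ℝ) + 1) ^ (a + b)) * V := by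
    ext i j
    rw [Matrix.mul_apply]
    simp only [ctgSub, momMat, Matrix.of_apply, Matrix.mul_diagonal, Matrix.conjTranspose_apply, V,
      star_trivial]
    refine Finset.sum_congr rfl fun t _ => ?_
    ring
  rw [e]
  apply Matrix.PosDef.conjTranspose_mul_mul_same
  · apply Matrix.PosDef.diagonal
    intro t; positivity
  · rw [Function.Injective]
    intro x y hxy
    rw [← sub_eq_zero]
    have hkn : k ≤ n := by omega
    apply Matrix.eq_zero_of_mulVec_eq_zero
      (M := Matrix.vandermonde (fun i : Fin k => ((i : ℕ) : ℝ) + 1))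
    · rw [Matrix.det_vandermonde_ne_zero_iff]
      intro i j h
      simpa [Fin.ext_iff] using h
    · rw [Matrix.mulVec_sub, sub_eq_zero]
      ext i
      exact congrFun hxy (Fin.castLE hkn i)

/-- Theorem 4.5. For `n`-by-`n` Hankel matrices `A` and `B`:
(a) if `A` and `B` are TN_r then `A ∘ B` is TN_r;
(b) if `A` and `B` are TP_r then `A ∘ B` is TP_r. -/
theorem hankel_hadamard_product_TNr_TPr {n : ℕ} (r : ℕ)
    (A B : Matrix (Fin n) (Fin n) ℝ) (hHA : IsHankel A) (hHB : IsHankel B) :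
    (IsTNr A r → IsTNr B r → IsTNr (Matrix.hadamard A B) r) ∧
    (IsTPr A r → IsTPr B r → IsTPr (Matrix.hadamard A B) r) := by
  refine ⟨fun hA hB => ?_, fun hA hB => hadamard_core A B (ctg_posDef A hHA hA)
    (ctg_posDef B hHB hB)⟩
  intro k hk f g hf hg
  have hpert : ∀ C : Matrix (Fin n) (Fin n) ℝ, IsHankel C → IsTNr C r → ∀ ε : ℝ, 0 < ε →
      ∀ k, k ≤ r → ∀ a b (ha : a + k ≤ n) (hb : b + k ≤ n),
        (ctgSub (C + ε • momMat n) k a b ha hb).PosDef := by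
    intro C hC hT ε hε k hk a b ha hb
    exact Matrix.PosDef.posSemidef_add (ctg_posSemidef C hC hT k hk a b ha hb)
      ((momMat_posDef k a b ha hb).smul hε)
  let F : ℝ → ℝ := fun ε =>
    ((Matrix.hadamard (A + ε • momMat n) (B + ε • momMat n)).submatrix f g).det
  have hF : Continuous F := by
    apply Continuous.matrix_det
    refine continuous_matrix fun i j => ?_
    simp only [Matrix.submatrix_apply, Matrix.hadamard_apply, Matrix.add_apply, Matrix.smul_apply]
    fun_prop
  have hF0 : F 0 = ((Matrix.hadamard A B).submatrix f g).det := by simp [F]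
  rw [← hF0]
  refine ge_of_tendsto (hF.continuousAt.tendsto.mono_left
    (nhdsWithin_le_nhds (s := Set.Ioi (0 : ℝ)))) ?_
  filter_upwards [self_mem_nhdsWithin] with ε hε
  exact (hadamard_core _ _ (hpert A hHA hA ε hε) (hpert B hHB hB ε hε) k hk f g hf hg).le
end

section
/- Let A be a 4-by-4 symmetric real matrix that is totally nonnegative (resp. totally positive). Then for every real number t ≥ 2 the Hadamard power A^{∘t} is totally nonnegative (resp. totally positive). -/
def QNN {n : ℕ} (M : Matrix (Fin n) (Fin n) ℝ) : Prop :=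
  M.IsSymm ∧ ∀ x : Fin n → ℝ, 0 ≤ ∑ i, ∑ j, x i * x j * M i j

theorem qnn_iff {n : ℕ} (M : Matrix (Fin n) (Fin n) ℝ) : QNN M ↔ M.PosSemidef := by
  rw [Matrix.posSemidef_iff_dotProduct_mulVec]
  have h1 : M.IsHermitian ↔ M.IsSymm := by
    rw [Matrix.IsHermitian, Matrix.IsSymm, Matrix.conjTranspose_eq_transpose_of_trivial]
  rw [h1]
  unfold QNN
  have h2 : ∀ x : Fin n → ℝ, star x ⬝ᵥ (M.mulVec x) = ∑ i, ∑ j, x i * x j * M i j := by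
    intro x
    simp only [dotProduct, Matrix.mulVec, Pi.star_apply, star_trivial, Finset.mul_sum]
    refine Finset.sum_congr rfl fun i _ => Finset.sum_congr rfl fun j _ => by ring
  simp only [h2]

noncomputable def schurc {n : ℕ} (M : Matrix (Fin (n+1)) (Fin (n+1)) ℝ) : Matrix (Fin n) (Fin n) ℝ :=
  Matrix.of fun i j => M i.succ j.succ - M i.succ 0 * M j.succ 0 / M 0 0

theorem form_split {n : ℕ} (M : Matrix (Fin (n+1)) (Fin (n+1)) ℝ) (hs : M.IsSymm)
    (h0 : M 0 0 = 0 → ∀ i, M i 0 = 0) (x : Fin (n+1) → ℝ) :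
    ∑ i, ∑ j, x i * x j * M i j =
      M 0 0 * (x 0 + (∑ i : Fin n, M i.succ 0 * x i.succ) / M 0 0) ^ 2
      + ∑ i : Fin n, ∑ j : Fin n, x i.succ * x j.succ * schurc M i j := by
  have e : ∀ j : Fin n, M 0 j.succ = M j.succ 0 := fun j => hs.apply _ _
  have h3 : ∑ i : Fin n, ∑ j : Fin n, x i.succ * x j.succ * schurc M i j
      = ∑ i : Fin n, ∑ j : Fin n, x i.succ * x j.succ * M i.succ j.succ
        - (∑ i : Fin n, M i.succ 0 * x i.succ) * (∑ i : Fin n, M i.succ 0 * x i.succ) / M 0 0 := by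
    rw [Finset.sum_mul_sum, Finset.sum_div, ← Finset.sum_sub_distrib]
    refine Finset.sum_congr rfl fun i _ => ?_
    rw [Finset.sum_div, ← Finset.sum_sub_distrib]
    refine Finset.sum_congr rfl fun j _ => ?_
    simp only [schurc, Matrix.of_apply]; ring
  rw [h3, Fin.sum_univ_succ]
  simp only [Fin.sum_univ_succ (n := n)]
  rw [Finset.sum_add_distrib]
  have h4 : ∑ j : Fin n, x 0 * x j.succ * M 0 j.succ = x 0 * ∑ i : Fin n, M i.succ 0 * x i.succ := by
    rw [Finset.mul_sum]; refine Finset.sum_congr rfl fun i _ => ?_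
    rw [e]; ring
  have h5 : ∑ i : Fin n, x i.succ * x 0 * M i.succ 0 = x 0 * ∑ i : Fin n, M i.succ 0 * x i.succ := by
    rw [Finset.mul_sum]; refine Finset.sum_congr rfl fun i _ => ?_
    ring
  rw [h4, h5]
  by_cases ha : M 0 0 = 0
  · have : ∑ i : Fin n, M i.succ 0 * x i.succ = 0 := by
      refine Finset.sum_eq_zero fun i _ => ?_
      rw [h0 ha]; ring
    rw [this, ha]; ring
  · field_simp; ring

theorem schurc_symm {n : ℕ} (M : Matrix (Fin (n+1)) (Fin (n+1)) ℝ) (hs : M.IsSymm) :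
    (schurc M).IsSymm := by
  ext i j
  simp only [schurc, Matrix.transpose_apply, Matrix.of_apply]
  rw [hs.apply]; ring

theorem QNN.zero_col {n : ℕ} {M : Matrix (Fin (n+1)) (Fin (n+1)) ℝ} (h : QNN M)
    (h0 : M 0 0 = 0) (i : Fin (n+1)) : M i 0 = 0 := by
  by_cases hi : i = 0
  · rw [hi, h0]
  have key : ∀ y : ℝ, 0 ≤ M i i + 2 * y * M i 0 := by
    intro y
    have := h.2 (fun k => (if k = i then 1 else 0) + (if k = 0 then y else 0))
    simp only [add_mul, mul_add, ite_mul, mul_ite, zero_mul, mul_zero, Finset.sum_add_distrib,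
      Finset.sum_ite_eq', Finset.mem_univ, if_true, Finset.sum_ite_eq] at this
    simp [h0] at this
    have e : M 0 i = M i 0 := h.1.apply _ _
    rw [e] at this
    linarith
  by_contra hne
  have := key (-(M i i + 1) / (2 * M i 0))
  have e : 2 * (-(M i i + 1) / (2 * M i 0)) * M i 0 = -(M i i + 1) := by field_simp
  linarith

theorem QNN.diag {n : ℕ} {M : Matrix (Fin n) (Fin n) ℝ} (h : QNN M) (i : Fin n) : 0 ≤ M i i :=
  ((qnn_iff M).1 h).diag_nonneg

theorem QNN.schur {n : ℕ} {M : Matrix (Fin (n+1)) (Fin (n+1)) ℝ} (h : QNN M) :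
    QNN (schurc M) := by
  refine ⟨schurc_symm M h.1, fun y => ?_⟩
  have := form_split M h.1 h.zero_col (Fin.cons (- (∑ i : Fin n, M i.succ 0 * y i) / M 0 0) y)
  simp only [Fin.cons_zero, Fin.cons_succ] at this
  have h2 := h.2 (Fin.cons (- (∑ i : Fin n, M i.succ 0 * y i) / M 0 0) y)
  rw [this] at h2
  have : M 0 0 * (- (∑ i : Fin n, M i.succ 0 * y i) / M 0 0
    + (∑ i : Fin n, M i.succ 0 * y i) / M 0 0) ^ 2 = 0 := by ring
  linarith

theorem QNN.hadamard {n : ℕ} {M N : Matrix (Fin n) (Fin n) ℝ} (h : QNN M) (h' : QNN N) :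
    QNN (Matrix.of fun i j => M i j * N i j) := by
  rw [qnn_iff] at *
  exact h.hadamard h'

/-- principal minors -/
theorem qnn_of_minors : ∀ {n : ℕ} (M : Matrix (Fin n) (Fin n) ℝ), M.IsSymm →
    (∀ (k : ℕ) (f : Fin k → Fin n), StrictMono f → 0 ≤ (M.submatrix f f).det) → QNN M := by
  intro n
  induction n with
  | zero => intro M hs _; exact ⟨hs, fun x => by simp⟩
  | succ n ih =>
    intro M hs hm
    have ha : 0 ≤ M 0 0 := by
      have := hm 1 (fun _ => 0) (Subsingleton.strictMono _)
      simpa using this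
    have hz : M 0 0 = 0 → ∀ i, M i 0 = 0 := by
      intro h0 i
      induction i using Fin.cases with
      | zero => exact h0
      | succ i =>
        have := hm 2 ![0, i.succ] (by
          intro a b hab
          fin_cases a <;> fin_cases b <;> simp at hab ⊢)
        rw [Matrix.det_fin_two] at this
        simp [h0] at this
        have e : M 0 i.succ = M i.succ 0 := hs.apply _ _
        rw [e] at this
        nlinarith
    have hq : QNN (schurc M) := by
      apply ih _ (schurc_symm M hs)
      intro k f hf
      by_cases h0 : M 0 0 = 0
      · have := hm k (fun i => (f i).succ) (fun a b h => by simpa using hf h)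
        convert this using 2
        ext i j
        simp [schurc, h0]
      · have hpos : 0 < M 0 0 := lt_of_le_of_ne ha (Ne.symm h0)
        have := hm (k+1) (Fin.cons 0 (fun i => (f i).succ)) (by
          intro a b hab
          induction a using Fin.cases with
          | zero =>
            induction b using Fin.cases with
            | zero => simp at hab
            | succ b => simp
          | succ a =>
            induction b using Fin.cases with
            | zero => simp at hab
            | succ b => simpa using hf (by simpa using hab))
        set B : Matrix (Fin (k+1)) (Fin (k+1)) ℝ := Matrix.of fun i j =>
          (Fin.cons (M 0 (Fin.cons (α := fun _ => Fin (n+1)) 0 (fun i => (f i).succ) j)) (fun i' : Fin k =>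
            (Fin.cons 0 (fun j' : Fin k => schurc M (f i') (f j')) : Fin (k+1) → ℝ) j) : Fin (k+1) → ℝ) i with hB
        have e1 : (M.submatrix (Fin.cons 0 (fun i => (f i).succ))
            (Fin.cons 0 (fun i => (f i).succ))).det = B.det := by
          refine Matrix.det_eq_of_forall_row_eq_smul_add_const
            (Fin.cons 0 (fun i => M (f i).succ 0 / M 0 0)) 0 (by simp) ?_
          intro i j
          induction i using Fin.cases with
          | zero => simp [hB]
          | succ i =>
            induction j using Fin.cases with
            | zero => simp [hB]; field_simp
            | succ j =>
              simp [hB, schurc]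
              have e : M 0 (f j).succ = M (f j).succ 0 := hs.apply _ _
              rw [e]; ring
        have e2 : B.det = M 0 0 * ((schurc M).submatrix f f).det := by
          rw [Matrix.det_succ_column_zero, Fin.sum_univ_succ]
          have : ∑ i : Fin k, (-1) ^ (i.succ : ℕ) * B i.succ 0
              * (B.submatrix i.succ.succAbove Fin.succ).det = 0 := by
            refine Finset.sum_eq_zero fun i _ => ?_
            simp [hB]
          rw [this]
          have e3 : B.submatrix (Fin.succAbove 0) Fin.succ = (schurc M).submatrix f f := by
            ext i j; simp [hB]
          rw [e3]; simp [hB]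
        rw [e1, e2] at this
        exact nonneg_of_mul_nonneg_right this hpos
    refine ⟨hs, fun x => ?_⟩
    rw [form_split M hs hz]
    exact add_nonneg (mul_nonneg ha (sq_nonneg _)) (hq.2 _)

theorem fh_step {n : ℕ} (t : ℝ) (ht : 1 ≤ t)
    (ih : ∀ M : Matrix (Fin n) (Fin n) ℝ, QNN M → (∀ i j, 0 ≤ M i j) → QNN (hadPow M (t - 1)))
    (M : Matrix (Fin (n+1)) (Fin (n+1)) ℝ) (hM : QNN M) (hn : ∀ i j, 0 ≤ M i j) :
    QNN (hadPow M t) := by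
  refine ⟨?_, fun x => ?_⟩
  · ext i j; simp only [hadPow, Matrix.transpose_apply, Matrix.of_apply]; rw [hM.1.apply]
  set c : Fin (n+1) → Fin (n+1) → ℝ := fun i j => M i 0 * M j 0 / M 0 0 with hc
  have hcn : ∀ i j, 0 ≤ c i j := fun i j => div_nonneg (mul_nonneg (hn _ _) (hn _ _)) (hn _ _)
  set h : ℝ → ℝ := fun s => ∑ i, ∑ j, x i * x j * (c i j + s * (M i j - c i j)) ^ t with hh
  have hd : ∀ s, HasDerivAt h
      (∑ i, ∑ j, x i * x j * ((M i j - c i j) * t * (c i j + s * (M i j - c i j)) ^ (t-1))) s := by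
    intro s
    refine HasDerivAt.fun_sum fun i _ => HasDerivAt.fun_sum fun j _ => ?_
    refine HasDerivAt.const_mul _ ?_
    refine HasDerivAt.rpow_const ?_ (Or.inr ht)
    simpa using ((hasDerivAt_id s).mul_const (M i j - c i j)).const_add (c i j)
  have hcol : ∀ i, M i 0 - c i 0 = 0 := by
    intro i
    by_cases h0 : M 0 0 = 0
    · simp [hc, hM.zero_col h0 i]
    · simp only [hc]; field_simp; ring
  have hrow : ∀ j, M 0 j - c 0 j = 0 := by
    intro j
    have h1 := hcol j
    have h2 : M 0 j = M j 0 := hM.1.apply _ _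
    have h3 : c 0 j = c j 0 := by simp only [hc]; ring
    rw [h2, h3, h1]
  have hpos : ∀ s, 0 ≤ s → s ≤ 1 →
      0 ≤ ∑ i, ∑ j, x i * x j * ((M i j - c i j) * t * (c i j + s * (M i j - c i j)) ^ (t-1)) := by
    intro s hs0 hs1
    have e : ∑ i, ∑ j, x i * x j * ((M i j - c i j) * t * (c i j + s * (M i j - c i j)) ^ (t-1))
      = t * ∑ i : Fin n, ∑ j : Fin n, x i.succ * x j.succ * ((schurc M i j) *
        (c i.succ j.succ + s * schurc M i j) ^ (t-1)) := by
      rw [Fin.sum_univ_succ]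
      simp only [Fin.sum_univ_succ (n := n), hcol, hrow]
      simp only [zero_mul, mul_zero, Finset.sum_const_zero, zero_add, add_zero, Finset.mul_sum]
      refine Finset.sum_congr rfl fun i _ => Finset.sum_congr rfl fun j _ => ?_
      have : M i.succ j.succ - c i.succ j.succ = schurc M i j := by simp [hc, schurc]
      rw [this]; ring
    rw [e]
    refine mul_nonneg (by linarith) ?_
    have hW : QNN (Matrix.of fun i j : Fin n => c i.succ j.succ + s * schurc M i j) := by
      refine ⟨?_, fun y => ?_⟩
      · ext i j
        simp only [Matrix.transpose_apply, Matrix.of_apply, (schurc_symm M hM.1).apply, hc]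
        ring
      · have e : ∑ i : Fin n, ∑ j : Fin n, y i * y j *
            (Matrix.of fun i j : Fin n => c i.succ j.succ + s * schurc M i j) i j =
            (∑ i : Fin n, y i * M i.succ 0) * (∑ i : Fin n, y i * M i.succ 0) / M 0 0
            + s * ∑ i : Fin n, ∑ j : Fin n, y i * y j * schurc M i j := by
          rw [Finset.sum_mul_sum, Finset.sum_div, Finset.mul_sum, ← Finset.sum_add_distrib]
          refine Finset.sum_congr rfl fun i _ => ?_
          rw [Finset.sum_div, Finset.mul_sum, ← Finset.sum_add_distrib]
          refine Finset.sum_congr rfl fun j _ => ?_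
          simp only [Matrix.of_apply, hc]; ring
        rw [e]
        exact add_nonneg (div_nonneg (mul_self_nonneg _) (hn _ _))
          (mul_nonneg hs0 (hM.schur.2 y))
    have := (hM.schur.hadamard (ih _ hW (fun i j => ?_))).2 (fun i => x i.succ)
    · simpa [hadPow] using this
    · simp only [Matrix.of_apply]
      have e : schurc M i j = M i.succ j.succ - c i.succ j.succ := by simp [hc, schurc]
      rw [e]
      nlinarith [hcn i.succ j.succ, hn i.succ j.succ]
  have hmono : MonotoneOn h (Set.Icc 0 1) := by
    apply monotoneOn_of_deriv_nonneg (convex_Icc 0 1)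
    · exact fun s _ => (hd s).continuousAt.continuousWithinAt
    · exact fun s _ => (hd s).differentiableAt.differentiableWithinAt
    · intro s hs
      rw [interior_Icc] at hs
      rw [(hd s).deriv]
      exact hpos s hs.1.le hs.2.le
  have h01 := hmono (Set.left_mem_Icc.2 zero_le_one) (Set.right_mem_Icc.2 zero_le_one) zero_le_one
  have e0 : h 0 = (∑ i, x i * M i 0 ^ t) * (∑ i, x i * M i 0 ^ t) / M 0 0 ^ t := by
    rw [Finset.sum_mul_sum, Finset.sum_div]
    simp only [hh]
    refine Finset.sum_congr rfl fun i _ => ?_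
    rw [Finset.sum_div]
    refine Finset.sum_congr rfl fun j _ => ?_
    simp only [hc, zero_mul, add_zero]
    rw [Real.div_rpow (mul_nonneg (hn _ _) (hn _ _)) (hn _ _), Real.mul_rpow (hn _ _) (hn _ _)]
    ring
  have e1 : h 1 = ∑ i, ∑ j, x i * x j * hadPow M t i j := by
    simp only [hh, hadPow, Matrix.of_apply, one_mul, add_sub_cancel]
  rw [← e1]
  refine le_trans ?_ h01
  rw [e0]
  exact div_nonneg (mul_self_nonneg _) (Real.rpow_nonneg (hn _ _) _)

theorem fh_two (t : ℝ) (ht : 0 ≤ t)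
    (M : Matrix (Fin 2) (Fin 2) ℝ) (hM : QNN M) (hn : ∀ i j, 0 ≤ M i j) :
    QNN (hadPow M t) := by
  have hs : (hadPow M t).IsSymm := by
    ext i j; simp only [hadPow, Matrix.transpose_apply, Matrix.of_apply]; rw [hM.1.apply]
  have hdet : 0 ≤ M.det := ((qnn_iff M).1 hM).det_nonneg
  rw [Matrix.det_fin_two] at hdet
  have e : M 1 0 = M 0 1 := hM.1.apply _ _
  have h1 : (M 0 1 * M 0 1) ^ t ≤ (M 0 0 * M 1 1) ^ t :=
    Real.rpow_le_rpow (mul_nonneg (hn _ _) (hn _ _)) (by rw [e] at hdet; linarith) ht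
  rw [Real.mul_rpow (hn _ _) (hn _ _), Real.mul_rpow (hn _ _) (hn _ _)] at h1
  refine ⟨hs, fun x => ?_⟩
  simp only [Fin.sum_univ_two, hadPow, Matrix.of_apply, e]
  have ha := Real.rpow_nonneg (hn 0 0) t
  have hb := Real.rpow_nonneg (hn 1 1) t
  generalize M 0 0 ^ t = a at *
  generalize M 0 1 ^ t = b at *
  generalize M 1 1 ^ t = d at *
  rcases ha.eq_or_lt with h | h
  · have : b = 0 := by nlinarith
    subst this; nlinarith [mul_nonneg hb (mul_self_nonneg (x 1))]
  · have : 0 ≤ a * (x 0 * x 0 * a + x 0 * x 1 * b + (x 1 * x 0 * b + x 1 * x 1 * d)) := by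
      nlinarith [mul_self_nonneg (a * x 0 + b * x 1), mul_nonneg (sub_nonneg.2 h1) (mul_self_nonneg (x 1))]
    exact nonneg_of_mul_nonneg_right this h

theorem fh_four (t : ℝ) (ht : 2 ≤ t)
    (M : Matrix (Fin 4) (Fin 4) ℝ) (hM : QNN M) (hn : ∀ i j, 0 ≤ M i j) :
    0 ≤ (hadPow M t).det := by
  refine ((qnn_iff _).1 ?_).det_nonneg
  refine fh_step t (by linarith) (fun N hN hNn => ?_) M hM hn
  refine fh_step (t-1) (by linarith) (fun N hN hNn => ?_) N hN hNn
  exact fh_two _ (by linarith) N hN hNn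

theorem slope_aux (t : ℝ) (ht : 1 ≤ t) (w z : ℝ) (hw : 0 ≤ w) (hwz : w ≤ z) (hz : z < 1) :
    (1 - z) * (1 - w ^ t) ≤ (1 - w) * (1 - z ^ t) := by
  have h1 : 0 < 1 - w := by linarith
  have := (convexOn_rpow ht).2 (Set.mem_Ici.2 hw) (Set.mem_Ici.2 (zero_le_one (α := ℝ)))
    (div_nonneg (show 0 ≤ 1 - z by linarith) h1.le)
    (div_nonneg (show 0 ≤ z - w by linarith) h1.le) (by field_simp; ring)
  simp only [smul_eq_mul, mul_one, Real.one_rpow] at this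
  have e : (1 - z) / (1 - w) * w + (z - w) / (1 - w) = z := by field_simp; ring
  rw [e, div_mul_eq_mul_div, ← add_div, le_div_iff₀ h1] at this
  linarith

theorem psi_aux (t : ℝ) (ht : 1 ≤ t) (x y : ℝ) (hx : 0 < x) (hxy : x ≤ y) :
    x * (1 + x) ^ (t - 1) * ((1 + y) ^ t - 1) ≤ y * (1 + y) ^ (t - 1) * ((1 + x) ^ t - 1) := by
  have hX : 0 < 1 + x := by linarith
  have hY : 0 < 1 + y := by linarith
  have := slope_aux t ht (1 + y)⁻¹ (1 + x)⁻¹ (by positivity)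
    (inv_anti₀ hX (by linarith)) (inv_lt_one_of_one_lt₀ (by linarith))
  rw [Real.inv_rpow hX.le, Real.inv_rpow hY.le] at this
  rw [Real.rpow_sub_one hX.ne', Real.rpow_sub_one hY.ne']
  have hp := Real.rpow_pos_of_pos hX t
  have hq := Real.rpow_pos_of_pos hY t
  generalize (1 + x) ^ t = p at *
  generalize (1 + y) ^ t = q at *
  have e1 : x * (p / (1 + x)) * (q - 1) = p * q * ((1 - (1 + x)⁻¹) * (1 - q⁻¹)) := by
    field_simp; ring
  have e2 : y * (q / (1 + y)) * (p - 1) = p * q * ((1 - (1 + y)⁻¹) * (1 - p⁻¹)) := by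
    field_simp; ring
  rw [e1, e2]
  exact mul_le_mul_of_nonneg_left this (by positivity)

theorem phi_aux (t : ℝ) (ht : 1 ≤ t) (l p q : ℝ) (hl : 1 ≤ l) (hp : 0 < p) (hpq : p ≤ q) :
    ((1 + l * p) ^ t - 1) * ((1 + q) ^ t - 1) ≤ ((1 + l * q) ^ t - 1) * ((1 + p) ^ t - 1) := by
  have hφ : ∀ x : ℝ, 0 < x → 0 < (1 + x) ^ t - 1 := fun x hx => by
    have := Real.one_lt_rpow (show 1 < 1 + x by linarith) (show 0 < t by linarith)
    linarith
  have hd : ∀ x : ℝ, 0 < x → HasDerivAt (fun x => ((1 + l * x) ^ t - 1) / ((1 + x) ^ t - 1))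
      (((l * t * (1 + l * x) ^ (t - 1)) * ((1 + x) ^ t - 1) -
        ((1 + l * x) ^ t - 1) * (1 * t * (1 + x) ^ (t - 1))) / ((1 + x) ^ t - 1) ^ 2) x := by
    intro x hx
    refine HasDerivAt.div ?_ ?_ (hφ x hx).ne'
    · refine HasDerivAt.sub_const _ (HasDerivAt.rpow_const ?_ (Or.inr ht))
      simpa using ((hasDerivAt_id x).const_mul l).const_add 1
    · refine HasDerivAt.sub_const _ (HasDerivAt.rpow_const ?_ (Or.inr ht))
      simpa using (hasDerivAt_id x).const_add 1
  have hmono : MonotoneOn (fun x => ((1 + l * x) ^ t - 1) / ((1 + x) ^ t - 1)) (Set.Ioi 0) := by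
    apply monotoneOn_of_deriv_nonneg (convex_Ioi 0)
    · exact fun s hs => (hd s hs).continuousAt.continuousWithinAt
    · rw [interior_Ioi]
      exact fun s hs => (hd s hs).differentiableAt.differentiableWithinAt
    · intro s hs
      rw [interior_Ioi] at hs
      have hs' : 0 < s := hs
      rw [(hd s hs).deriv]
      refine div_nonneg ?_ (sq_nonneg _)
      have := psi_aux t ht s (l * s) hs' (by nlinarith)
      refine nonneg_of_mul_nonneg_right (a := s) ?_ hs'
      have h2 := mul_le_mul_of_nonneg_left this (show 0 ≤ t by linarith)
      linarith
  have := hmono (Set.mem_Ioi.2 hp) (Set.mem_Ioi.2 (hp.trans_le hpq)) hpq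
  simp only at this
  rwa [div_le_div_iff₀ (hφ p hp) (hφ q (hp.trans_le hpq))] at this

theorem norm_aux (t : ℝ) (ht : 1 ≤ t) (a b c d : ℝ) (ha : 1 < a) (hb : a ≤ b) (hc : a ≤ c)
    (h : (b - 1) * (c - 1) = (a - 1) * (d - 1)) :
    (b ^ t - 1) * (c ^ t - 1) ≤ (a ^ t - 1) * (d ^ t - 1) := by
  have h0 : 0 < a - 1 := by linarith
  have := phi_aux t ht ((b - 1) / (a - 1)) (a - 1) (c - 1)
    (by rw [le_div_iff₀ h0]; linarith) h0 (by linarith)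
  have e1 : 1 + (b - 1) / (a - 1) * (a - 1) = b := by field_simp; ring
  have e2 : 1 + (b - 1) / (a - 1) * (c - 1) = d := by
    rw [div_mul_eq_mul_div, h]; field_simp; ring
  rw [e1, e2] at this
  simp only [add_sub_cancel] at this
  linarith

theorem norm_le (t : ℝ) (ht : 1 ≤ t) (a b c d : ℝ) (ha : 1 ≤ a) (hb : a ≤ b) (hc : a ≤ c)
    (h : (b - 1) * (c - 1) ≤ (a - 1) * (d - 1)) :
    (b ^ t - 1) * (c ^ t - 1) ≤ (a ^ t - 1) * (d ^ t - 1) := by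
  rcases ha.eq_or_lt with h1 | h1
  · subst h1
    have h2 : (b - 1) * (c - 1) = 0 :=
      le_antisymm (by linarith) (mul_nonneg (by linarith) (by linarith))
    rcases mul_eq_zero.1 h2 with h3 | h3
    · rw [show b = 1 by linarith]; simp
    · rw [show c = 1 by linarith]; simp
  · have h0 : 0 < a - 1 := by linarith
    have key := norm_aux t ht a b c (1 + (b - 1) * (c - 1) / (a - 1)) h1 hb hc (by field_simp; ring)
    have hp : 0 ≤ (b - 1) * (c - 1) / (a - 1) :=
      div_nonneg (mul_nonneg (by linarith) (by linarith)) h0.le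
    have h4 : 1 + (b - 1) * (c - 1) / (a - 1) ≤ d := by
      have : (b - 1) * (c - 1) / (a - 1) ≤ d - 1 := by rw [div_le_iff₀ h0]; linarith
      linarith
    have h5 := Real.rpow_le_rpow (by linarith) h4 (show 0 ≤ t by linarith)
    have h6 := Real.one_lt_rpow h1 (show 0 < t by linarith)
    exact key.trans (mul_le_mul_of_nonneg_left (by linarith) (by linarith))

theorem norm_lt (t : ℝ) (ht : 1 ≤ t) (a b c d : ℝ) (h1 : 1 < a) (hb : a ≤ b) (hc : a ≤ c)
    (h : (b - 1) * (c - 1) < (a - 1) * (d - 1)) :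
    (b ^ t - 1) * (c ^ t - 1) < (a ^ t - 1) * (d ^ t - 1) := by
  have h0 : 0 < a - 1 := by linarith
  have key := norm_aux t ht a b c (1 + (b - 1) * (c - 1) / (a - 1)) h1 hb hc (by field_simp; ring)
  have hp : 0 ≤ (b - 1) * (c - 1) / (a - 1) :=
    div_nonneg (mul_nonneg (by linarith) (by linarith)) h0.le
  have h4 : 1 + (b - 1) * (c - 1) / (a - 1) < d := by
    have : (b - 1) * (c - 1) / (a - 1) < d - 1 := by rw [div_lt_iff₀ h0]; linarith
    linarith
  have h5 := Real.rpow_lt_rpow (by linarith) h4 (show 0 < t by linarith)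
  have h6 := Real.one_lt_rpow h1 (show 0 < t by linarith)
  exact key.trans_lt (mul_lt_mul_of_pos_left (by linarith) (by linarith))

def DD (a b c d e f g h i : ℝ) : ℝ :=
  a * e * i - a * f * h - b * d * i + b * f * g + c * d * h - c * e * g

theorem raw_factor (t a b c d g p q r s : ℝ) (ha : 0 < a) (hb : 0 < b) (hc : 0 < c) (hd : 0 < d)
    (hg : 0 < g) (hp : 0 ≤ p) (hq : 0 ≤ q) (hr : 0 ≤ r) (hs : 0 ≤ s) :
    DD (a ^ t) (b ^ t) (c ^ t) (d ^ t) ((p * (d * b / a)) ^ t) ((q * (d * c / a)) ^ t) (g ^ t)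
      ((r * (g * b / a)) ^ t) ((s * (g * c / a)) ^ t) =
    (b ^ t * c ^ t * d ^ t * g ^ t / a ^ t) * ((p ^ t - 1) * (s ^ t - 1) - (q ^ t - 1) * (r ^ t - 1)) := by
  have hat := Real.rpow_pos_of_pos ha t
  have key : ∀ p x y : ℝ, 0 ≤ p → 0 < x → 0 < y →
      (p * (x * y / a)) ^ t = p ^ t * (x ^ t * y ^ t / a ^ t) := by
    intro p x y hp hx hy
    rw [Real.mul_rpow hp (by positivity), Real.div_rpow (by positivity) ha.le,
      Real.mul_rpow hx.le hy.le]
  rw [key p d b hp hd hb, key q d c hq hd hc, key r g b hr hg hb, key s g c hs hg hc]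
  unfold DD
  field_simp
  ring

theorem raw_factor1 (a b c d g p q r s : ℝ) (ha : 0 < a) :
    DD a b c d (p * (d * b / a)) (q * (d * c / a)) g (r * (g * b / a)) (s * (g * c / a)) =
    (b * c * d * g / a) * ((p - 1) * (s - 1) - (q - 1) * (r - 1)) := by
  unfold DD
  field_simp
  ring

theorem raw_subst (a b c d e f g h i : ℝ) (ha : 0 < a) (hb : 0 < b) (hc : 0 < c) (hd : 0 < d)
    (hg : 0 < g) (he : 0 ≤ e) (hf : 0 ≤ f) (hh : 0 ≤ h) (hi : 0 ≤ i)
    (h1 : b * d ≤ a * e) (h2 : c * e ≤ b * f) (h3 : e * g ≤ d * h) :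
    ∃ p q r s : ℝ, 1 ≤ p ∧ p ≤ q ∧ p ≤ r ∧ 0 ≤ s ∧ e = p * (d * b / a) ∧ f = q * (d * c / a) ∧
      h = r * (g * b / a) ∧ i = s * (g * c / a) ∧ (b * d < a * e → 1 < p) := by
  refine ⟨e / (d * b / a), f / (d * c / a), h / (g * b / a), i / (g * c / a), ?_, ?_, ?_, ?_, ?_, ?_,
    ?_, ?_, ?_⟩
  · rw [le_div_iff₀ (by positivity), one_mul, div_le_iff₀ ha]; linarith
  · rw [div_le_div_iff₀ (by positivity) (by positivity)]
    have : 0 ≤ (d / a) * (b * f - c * e) := mul_nonneg (by positivity) (by linarith)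
    have e1 : f * (d * b / a) - e * (d * c / a) = (d / a) * (b * f - c * e) := by ring
    linarith
  · rw [div_le_div_iff₀ (by positivity) (by positivity)]
    have : 0 ≤ (b / a) * (d * h - e * g) := mul_nonneg (by positivity) (by linarith)
    have e1 : h * (d * b / a) - e * (g * b / a) = (b / a) * (d * h - e * g) := by ring
    linarith
  · positivity
  · field_simp
  · field_simp
  · field_simp
  · field_simp
  · intro hlt
    rw [lt_div_iff₀ (by positivity), one_mul, div_lt_iff₀ ha]; linarith

theorem raw1 (t : ℝ) (ht : 1 ≤ t) (a b c d e f g h i : ℝ) (ha : 0 < a) (hb : 0 < b) (hc : 0 < c)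
    (hd : 0 < d) (hg : 0 < g) (he : 0 ≤ e) (hf : 0 ≤ f) (hh : 0 ≤ h) (hi : 0 ≤ i)
    (h1 : b * d ≤ a * e) (h2 : c * e ≤ b * f) (h3 : e * g ≤ d * h)
    (hD : 0 ≤ DD a b c d e f g h i) :
    0 ≤ DD (a ^ t) (b ^ t) (c ^ t) (d ^ t) (e ^ t) (f ^ t) (g ^ t) (h ^ t) (i ^ t) := by
  obtain ⟨p, q, r, s, hp, hq, hr, hs, rfl, rfl, rfl, rfl, -⟩ :=
    raw_subst a b c d e f g h i ha hb hc hd hg he hf hh hi h1 h2 h3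
  rw [raw_factor1 _ _ _ _ _ _ _ _ _ ha] at hD
  rw [raw_factor t a b c d g p q r s ha hb hc hd hg (by linarith) (by linarith) (by linarith) hs]
  have hD' := nonneg_of_mul_nonneg_right hD (by positivity)
  have := norm_le t ht p q r s hp hq hr (by linarith)
  exact mul_nonneg (by positivity) (by linarith)

theorem raw1_lt (t : ℝ) (ht : 1 ≤ t) (a b c d e f g h i : ℝ) (ha : 0 < a) (hb : 0 < b) (hc : 0 < c)
    (hd : 0 < d) (hg : 0 < g) (he : 0 ≤ e) (hf : 0 ≤ f) (hh : 0 ≤ h) (hi : 0 ≤ i)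
    (h1 : b * d < a * e) (h2 : c * e ≤ b * f) (h3 : e * g ≤ d * h)
    (hD : 0 < DD a b c d e f g h i) :
    0 < DD (a ^ t) (b ^ t) (c ^ t) (d ^ t) (e ^ t) (f ^ t) (g ^ t) (h ^ t) (i ^ t) := by
  obtain ⟨p, q, r, s, hp, hq, hr, hs, rfl, rfl, rfl, rfl, hp1⟩ :=
    raw_subst a b c d e f g h i ha hb hc hd hg he hf hh hi h1.le h2 h3
  rw [raw_factor1 _ _ _ _ _ _ _ _ _ ha] at hD
  rw [raw_factor t a b c d g p q r s ha hb hc hd hg (by linarith) (by linarith) (by linarith) hs]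
  have hD' := pos_of_mul_pos_right hD (by positivity)
  have := norm_lt t ht p q r s (hp1 h1) hq hr (by linarith)
  exact mul_pos (by positivity) (by linarith)

theorem min_pow (t : ℝ) (ht : 1 ≤ t) (a b d e : ℝ) (ha : 0 ≤ a) (hb : 0 ≤ b) (hd : 0 ≤ d)
    (he : 0 ≤ e) (h : b * d ≤ a * e) : b ^ t * d ^ t ≤ a ^ t * e ^ t := by
  rw [← Real.mul_rpow hb hd, ← Real.mul_rpow ha he]
  exact Real.rpow_le_rpow (mul_nonneg hb hd) h (by linarith)

theorem raw2 (t : ℝ) (ht : 1 ≤ t) (a b c d e f g h i : ℝ) (ha : 0 < a) (hb : 0 < b) (hc : 0 ≤ c)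
    (hd : 0 < d) (hg : 0 < g) (he : 0 ≤ e) (hf : 0 ≤ f) (hh : 0 ≤ h) (hi : 0 ≤ i)
    (h1 : b * d ≤ a * e) (h2 : c * e ≤ b * f) (h3 : e * g ≤ d * h)
    (hD : 0 ≤ DD a b c d e f g h i) :
    0 ≤ DD (a ^ t) (b ^ t) (c ^ t) (d ^ t) (e ^ t) (f ^ t) (g ^ t) (h ^ t) (i ^ t) := by
  have ht0 : t ≠ 0 := by linarith
  rcases hc.eq_or_lt with h0 | h0
  · subst h0
    rcases hf.eq_or_lt with hf0 | hf0
    · subst hf0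
      have := min_pow t ht a b d e ha.le hb.le hd.le he h1
      have hi' := Real.rpow_nonneg hi t
      unfold DD
      rw [Real.zero_rpow ht0]
      nlinarith [mul_nonneg hi' (sub_nonneg.2 this)]
    · have he' : 0 < e := pos_of_mul_pos_right (lt_of_lt_of_le (mul_pos hb hd) h1) ha.le
      have hlim : Filter.Tendsto (fun x : ℝ =>
          DD (a ^ t) (b ^ t) (x ^ t) (d ^ t) (e ^ t) (f ^ t) (g ^ t) (h ^ t) (i ^ t))
          (nhdsWithin 0 (Set.Ioi 0))
          (nhds (DD (a ^ t) (b ^ t) (0 ^ t) (d ^ t) (e ^ t) (f ^ t) (g ^ t) (h ^ t) (i ^ t))) := by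
        refine Filter.Tendsto.mono_left ?_ nhdsWithin_le_nhds
        have hx : Continuous (fun x : ℝ => x ^ t) := Real.continuous_rpow_const (by linarith)
        have : Continuous (fun x : ℝ =>
          DD (a ^ t) (b ^ t) (x ^ t) (d ^ t) (e ^ t) (f ^ t) (g ^ t) (h ^ t) (i ^ t)) := by
          unfold DD; fun_prop
        exact this.tendsto 0
      refine ge_of_tendsto hlim ?_
      have hev : Set.Ioo 0 (b * f / e) ∈ nhdsWithin (0 : ℝ) (Set.Ioi 0) :=
        Ioo_mem_nhdsGT (by positivity)
      filter_upwards [hev] with x hx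
      refine raw1 t ht a b x d e f g h i ha hb hx.1 hd hg he hf hh hi h1 ?_ h3 ?_
      · have := hx.2
        rw [lt_div_iff₀ he'] at this
        exact this.le
      · unfold DD at *
        nlinarith [mul_nonneg hx.1.le (sub_nonneg.2 h3)]
  · exact raw1 t ht a b c d e f g h i ha hb h0 hd hg he hf hh hi h1 h2 h3 hD

theorem raw3 (t : ℝ) (ht : 1 ≤ t) (a b c d e f g h i : ℝ) (ha : 0 < a) (hb : 0 < b) (hc : 0 ≤ c)
    (hd : 0 < d) (hg : 0 ≤ g) (he : 0 ≤ e) (hf : 0 ≤ f) (hh : 0 ≤ h) (hi : 0 ≤ i)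
    (h1 : b * d ≤ a * e) (h2 : c * e ≤ b * f) (h3 : e * g ≤ d * h)
    (hD : 0 ≤ DD a b c d e f g h i) :
    0 ≤ DD (a ^ t) (b ^ t) (c ^ t) (d ^ t) (e ^ t) (f ^ t) (g ^ t) (h ^ t) (i ^ t) := by
  have ht0 : t ≠ 0 := by linarith
  rcases hg.eq_or_lt with h0 | h0
  · subst h0
    rcases hh.eq_or_lt with hf0 | hf0
    · subst hf0
      have := min_pow t ht a b d e ha.le hb.le hd.le he h1
      have hi' := Real.rpow_nonneg hi t
      unfold DD
      rw [Real.zero_rpow ht0]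
      nlinarith [mul_nonneg hi' (sub_nonneg.2 this)]
    · have he' : 0 < e := pos_of_mul_pos_right (lt_of_lt_of_le (mul_pos hb hd) h1) ha.le
      have hlim : Filter.Tendsto (fun x : ℝ =>
          DD (a ^ t) (b ^ t) (c ^ t) (d ^ t) (e ^ t) (f ^ t) (x ^ t) (h ^ t) (i ^ t))
          (nhdsWithin 0 (Set.Ioi 0))
          (nhds (DD (a ^ t) (b ^ t) (c ^ t) (d ^ t) (e ^ t) (f ^ t) (0 ^ t) (h ^ t) (i ^ t))) := by
        refine Filter.Tendsto.mono_left ?_ nhdsWithin_le_nhds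
        have hx : Continuous (fun x : ℝ => x ^ t) := Real.continuous_rpow_const (by linarith)
        have : Continuous (fun x : ℝ =>
          DD (a ^ t) (b ^ t) (c ^ t) (d ^ t) (e ^ t) (f ^ t) (x ^ t) (h ^ t) (i ^ t)) := by
          unfold DD; fun_prop
        exact this.tendsto 0
      refine ge_of_tendsto hlim ?_
      have hev : Set.Ioo 0 (d * h / e) ∈ nhdsWithin (0 : ℝ) (Set.Ioi 0) :=
        Ioo_mem_nhdsGT (by positivity)
      filter_upwards [hev] with x hx
      refine raw2 t ht a b c d e f x h i ha hb hc hd hx.1 he hf hh hi h1 h2 ?_ ?_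
      · have := hx.2
        rw [lt_div_iff₀ he'] at this
        linarith
      · unfold DD at *
        nlinarith [mul_nonneg hx.1.le (sub_nonneg.2 h2)]
  · exact raw2 t ht a b c d e f g h i ha hb hc hd h0 he hf hh hi h1 h2 h3 hD

theorem raw4 (t : ℝ) (ht : 1 ≤ t) (a b c d e f g h i : ℝ) (ha : 0 ≤ a) (hb : 0 ≤ b) (hc : 0 ≤ c)
    (hd : 0 ≤ d) (hg : 0 ≤ g) (he : 0 ≤ e) (hf : 0 ≤ f) (hh : 0 ≤ h) (hi : 0 ≤ i)
    (m33 : b * d ≤ a * e) (m31 : c * e ≤ b * f) (m13 : e * g ≤ d * h)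
    (m32 : c * d ≤ a * f) (m23 : b * g ≤ a * h) (m22 : c * g ≤ a * i) (m21 : c * h ≤ b * i)
    (m12 : f * g ≤ d * i) (m11 : f * h ≤ e * i)
    (hD : 0 ≤ DD a b c d e f g h i) :
    0 ≤ DD (a ^ t) (b ^ t) (c ^ t) (d ^ t) (e ^ t) (f ^ t) (g ^ t) (h ^ t) (i ^ t) := by
  have ht0 : t ≠ 0 := by linarith
  have z : (0 : ℝ) ^ t = 0 := Real.zero_rpow ht0
  have k11 := min_pow t ht e f h i he hf hh hi m11
  have hat := Real.rpow_nonneg ha t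
  have pz : ∀ x y : ℝ, 0 ≤ x → 0 ≤ y → x * y ≤ 0 → x = 0 ∨ y = 0 := fun x y hx hy h =>
    mul_eq_zero.1 (le_antisymm h (mul_nonneg hx hy))
  have corner : b = 0 ∧ c = 0 ∨ d = 0 ∧ g = 0 →
      0 ≤ DD (a ^ t) (b ^ t) (c ^ t) (d ^ t) (e ^ t) (f ^ t) (g ^ t) (h ^ t) (i ^ t) := by
    have := mul_nonneg hat (sub_nonneg.2 k11)
    rintro (⟨rfl, rfl⟩ | ⟨rfl, rfl⟩) <;> unfold DD <;> rw [z] <;> linarith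
  have col2 : b = 0 → e = 0 → h = 0 →
      0 ≤ DD (a ^ t) (b ^ t) (c ^ t) (d ^ t) (e ^ t) (f ^ t) (g ^ t) (h ^ t) (i ^ t) := by
    rintro rfl rfl rfl; unfold DD; rw [z]; simp
  have row2 : d = 0 → e = 0 → f = 0 →
      0 ≤ DD (a ^ t) (b ^ t) (c ^ t) (d ^ t) (e ^ t) (f ^ t) (g ^ t) (h ^ t) (i ^ t) := by
    rintro rfl rfl rfl; unfold DD; rw [z]; simp
  have bcase : b = 0 →
      0 ≤ DD (a ^ t) (b ^ t) (c ^ t) (d ^ t) (e ^ t) (f ^ t) (g ^ t) (h ^ t) (i ^ t) := by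
    intro h0
    rcases pz c e hc he (by rw [h0] at m31; linarith) with h1 | h1
    · exact corner (Or.inl ⟨h0, h1⟩)
    rcases pz c h hc hh (by rw [h0] at m21; linarith) with h2 | h2
    · exact corner (Or.inl ⟨h0, h2⟩)
    exact col2 h0 h1 h2
  have dcase : d = 0 →
      0 ≤ DD (a ^ t) (b ^ t) (c ^ t) (d ^ t) (e ^ t) (f ^ t) (g ^ t) (h ^ t) (i ^ t) := by
    intro h0
    rcases pz e g he hg (by rw [h0] at m13; linarith) with h1 | h1
    · rcases pz f g hf hg (by rw [h0] at m12; linarith) with h2 | h2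
      · exact row2 h0 h1 h2
      · exact corner (Or.inr ⟨h0, h2⟩)
    · exact corner (Or.inr ⟨h0, h1⟩)
  rcases hb.eq_or_lt with h0 | hb
  · exact bcase h0.symm
  rcases hd.eq_or_lt with h0 | hd
  · exact dcase h0.symm
  rcases ha.eq_or_lt with h0 | ha
  · exfalso
    rw [← h0] at m33
    nlinarith [mul_pos hb hd]
  exact raw3 t ht a b c d e f g h i ha hb hc hd hg he hf hh hi m33 m31 m13 hD

theorem strictMono_pair {n : ℕ} {i j : Fin n} (h : i < j) : StrictMono ![i, j] := by
  intro a b hab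
  fin_cases a <;> fin_cases b <;> simp at hab ⊢
  exact h

theorem entry_nonneg {n r : ℕ} {A : Matrix (Fin n) (Fin n) ℝ} (hr : 1 ≤ r) (h : IsTNr A r)
    (i j : Fin n) : 0 ≤ A i j := by
  have := h 1 hr (fun _ => i) (fun _ => j) (Subsingleton.strictMono _) (Subsingleton.strictMono _)
  simpa using this

theorem minor_nonneg {n r : ℕ} {A : Matrix (Fin n) (Fin n) ℝ} (hr : 2 ≤ r) (h : IsTNr A r)
    {i i' j j' : Fin n} (hi : i < i') (hj : j < j') : A i j' * A i' j ≤ A i j * A i' j' := by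
  have := h 2 hr _ _ (strictMono_pair hi) (strictMono_pair hj)
  rw [Matrix.det_fin_two] at this
  simp at this
  linarith

theorem minor_pos {n r : ℕ} {A : Matrix (Fin n) (Fin n) ℝ} (hr : 2 ≤ r) (h : IsTPr A r)
    {i i' j j' : Fin n} (hi : i < i') (hj : j < j') : A i j' * A i' j < A i j * A i' j' := by
  have := h 2 hr _ _ (strictMono_pair hi) (strictMono_pair hj)
  rw [Matrix.det_fin_two] at this
  simp at this
  linarith

theorem entry_pos {n r : ℕ} {A : Matrix (Fin n) (Fin n) ℝ} (hr : 1 ≤ r) (h : IsTPr A r)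
    (i j : Fin n) : 0 < A i j := by
  have := h 1 hr (fun _ => i) (fun _ => j) (Subsingleton.strictMono _) (Subsingleton.strictMono _)
  simpa using this

theorem three_nonneg (t : ℝ) (ht : 1 ≤ t) {A : Matrix (Fin 4) (Fin 4) ℝ} (h : IsTNr A 4)
    (f g : Fin 3 → Fin 4) (hf : StrictMono f) (hg : StrictMono g) :
    0 ≤ ((hadPow A t).submatrix f g).det := by
  have hD := h 3 (by norm_num) f g hf hg
  have f01 : f 0 < f 1 := hf (by decide)
  have f02 : f 0 < f 2 := hf (by decide)
  have f12 : f 1 < f 2 := hf (by decide)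
  have g01 : g 0 < g 1 := hg (by decide)
  have g02 : g 0 < g 2 := hg (by decide)
  have g12 : g 1 < g 2 := hg (by decide)
  have E := entry_nonneg (by norm_num) h
  have m : ∀ {i i' j j' : Fin 4}, i < i' → j < j' → A i j' * A i' j ≤ A i j * A i' j' :=
    fun hi hj => minor_nonneg (by norm_num) h hi hj
  rw [Matrix.det_fin_three] at hD ⊢
  simp only [Matrix.submatrix_apply, hadPow, Matrix.of_apply] at hD ⊢
  refine raw4 t ht _ _ _ _ _ _ _ _ _ (E _ _) (E _ _) (E _ _) (E _ _) (E _ _) (E _ _) (E _ _)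
    (E _ _) (E _ _) (m f01 g01) (m f01 g12) ?_ (m f01 g02) (m f02 g01) (m f02 g02) (m f02 g12)
    (m f12 g02) (m f12 g12) hD
  exact m f12 g01

theorem three_min_pos (t : ℝ) (ht : 1 ≤ t) {A : Matrix (Fin 4) (Fin 4) ℝ} (h : IsTPr A 4)
    (f g : Fin 3 → Fin 4) (hf : StrictMono f) (hg : StrictMono g) :
    0 < ((hadPow A t).submatrix f g).det := by
  have hD := h 3 (by norm_num) f g hf hg
  have f01 : f 0 < f 1 := hf (by decide)
  have f12 : f 1 < f 2 := hf (by decide)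
  have g01 : g 0 < g 1 := hg (by decide)
  have g12 : g 1 < g 2 := hg (by decide)
  have E := entry_pos (by norm_num) h
  have m : ∀ {i i' j j' : Fin 4}, i < i' → j < j' → A i j' * A i' j < A i j * A i' j' :=
    fun hi hj => minor_pos (by norm_num) h hi hj
  rw [Matrix.det_fin_three] at hD ⊢
  simp only [Matrix.submatrix_apply, hadPow, Matrix.of_apply] at hD ⊢
  refine raw1_lt t ht _ _ _ _ _ _ _ _ _ (E _ _) (E _ _) (E _ _) (E _ _) (E _ _) (E _ _).le (E _ _).le
    (E _ _).le (E _ _).le (m f01 g01) (m f01 g12).le ?_ hD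
  exact (m f12 g01).le

theorem strictMono_four (f : Fin 4 → Fin 4) (hf : StrictMono f) : f = id := by
  refine (hf.range_inj strictMono_id).1 ?_
  rw [Set.range_id, (Finite.surjective_of_injective hf.injective).range_eq]

theorem det_four_split (B C : Matrix (Fin 4) (Fin 4) ℝ)
    (h : ∀ i j, ¬ (i = 3 ∧ j = 3) → B i j = C i j) :
    B.det = C.det + (B 3 3 - C 3 3) * (B.submatrix (Fin.castSucc : Fin 3 → Fin 4) Fin.castSucc).det := by
  have e : ∀ M : Matrix (Fin 4) (Fin 4) ℝ, M.det =
    M 3 3 * (M.submatrix (Fin.castSucc : Fin 3 → Fin 4) Fin.castSucc).det +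
     (∑ j : Fin 3, (-1) ^ (3 + (j : ℕ)) * M 3 j.castSucc *
      (M.submatrix (Fin.succAbove 3) (Fin.succAbove j.castSucc)).det) := by
    intro M
    rw [Matrix.det_succ_row M 3, Fin.sum_univ_castSucc, add_comm]
    congr 1
    have : (Fin.succAbove (3 : Fin 4)) = (Fin.castSucc : Fin 3 → Fin 4) := by
      funext i; fin_cases i <;> rfl
    have e3 : Fin.last 3 = (3 : Fin 4) := rfl
    rw [e3, this]
    norm_num
  rw [e B, e C]
  have h1 : C.submatrix (Fin.castSucc : Fin 3 → Fin 4) Fin.castSucc = B.submatrix Fin.castSucc Fin.castSucc := by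
    ext i j
    simp only [Matrix.submatrix_apply]
    refine (h _ _ ?_).symm
    rintro ⟨h1, -⟩
    exact absurd h1 (Fin.castSucc_lt_last i).ne
  have h2 : ∀ j : Fin 3, C.submatrix (Fin.succAbove 3) (Fin.succAbove j.castSucc) =
      B.submatrix (Fin.succAbove 3) (Fin.succAbove j.castSucc) := by
    intro j
    ext i k
    simp only [Matrix.submatrix_apply]
    refine (h _ _ ?_).symm
    rintro ⟨h1, -⟩
    exact absurd h1 (Fin.succAbove_ne _ _)
  have h3 : ∀ j : Fin 3, C 3 j.castSucc = B 3 j.castSucc := by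
    intro j
    refine (h _ _ ?_).symm
    rintro ⟨-, h1⟩
    exact absurd h1 (Fin.castSucc_lt_last j).ne
  simp only [h1, h2, h3]
  ring

theorem four_nonneg (t : ℝ) (ht : 2 ≤ t) {A : Matrix (Fin 4) (Fin 4) ℝ} (hs : A.IsSymm)
    (h : IsTNr A 4) : 0 ≤ (hadPow A t).det := by
  refine fh_four t ht A (qnn_of_minors A hs fun k f hf => ?_) (entry_nonneg (by norm_num) h)
  refine h k ?_ f f hf hf
  simpa using Fintype.card_le_of_injective f hf.injective

theorem four_det_pos (t : ℝ) (ht : 2 ≤ t) {A : Matrix (Fin 4) (Fin 4) ℝ} (hs : A.IsSymm)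
    (h : IsTPr A 4) : 0 < (hadPow A t).det := by
  set A' : ℝ → Matrix (Fin 4) (Fin 4) ℝ := fun x =>
    Matrix.of fun i j => A i j - (if i = 3 ∧ j = 3 then x else 0) with hA'
  have hA0 : A' 0 = A := by ext i j; simp [hA']
  have hcont : Continuous A' := by
    refine continuous_matrix fun i j => ?_
    simp only [hA', Matrix.of_apply]
    split_ifs <;> fun_prop
  have hev : ∀ᶠ x in nhds (0 : ℝ), ∀ (k : Fin 5) (f : Fin k → Fin 4), StrictMono f →
      0 < ((A' x).submatrix f f).det := by
    rw [Filter.eventually_all]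
    intro k
    rw [Filter.eventually_all]
    intro f
    by_cases hf : StrictMono f
    · have hc : Continuous fun x => ((A' x).submatrix f f).det := (hcont.matrix_submatrix f f).matrix_det
      have h0 : 0 < ((A' 0).submatrix f f).det := by
        rw [hA0]; exact h k (by omega) f f hf hf
      filter_upwards [hc.continuousAt.eventually (lt_mem_nhds h0)] with x hx _ using hx
    · exact Filter.Eventually.of_forall fun x hf' => absurd hf' hf
  have hev2 := (hev.filter_mono (nhdsWithin_le_nhds (s := Set.Ioi 0))).and self_mem_nhdsWithin
  obtain ⟨x, hx, hx0⟩ := hev2.exists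
  have hx0 : 0 < x := hx0
  have hE := entry_pos (by norm_num) h
  have hd3 : 0 < A' x 3 3 := by
    have := hx ⟨1, by norm_num⟩ (fun _ => 3)
      (Subsingleton.strictMono (α := Fin 1) (fun _ => (3 : Fin 4)))
    simpa using this
  have hne : ∀ i j, ¬ (i = 3 ∧ j = 3) → A i j = A' x i j := by
    intro i j hij; simp [hA', hij]
  have hsx : (A' x).IsSymm := by
    ext i j
    simp only [hA', Matrix.transpose_apply, Matrix.of_apply, hs.apply, and_comm]
  have hq : QNN (A' x) := qnn_of_minors _ hsx fun k f hf => by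
    have hk : k ≤ 4 := by simpa using Fintype.card_le_of_injective f hf.injective
    exact (hx ⟨k, by omega⟩ f hf).le
  have h4 := fh_four t ht (A' x) hq (fun i j => by
    by_cases hij : i = 3 ∧ j = 3
    · rw [hij.1, hij.2]; exact hd3.le
    · rw [← hne i j hij]; exact (hE i j).le)
  rw [det_four_split (hadPow A t) (hadPow (A' x) t) (fun i j hij => by
    simp only [hadPow, Matrix.of_apply, hne i j hij])]
  have h3 := three_min_pos t (by linarith) h Fin.castSucc Fin.castSucc
    (Fin.strictMono_castSucc) (Fin.strictMono_castSucc)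
  have h5 : 0 < hadPow A t 3 3 - hadPow (A' x) t 3 3 := by
    simp only [hadPow, Matrix.of_apply, sub_pos]
    refine Real.rpow_lt_rpow hd3.le ?_ (by linarith)
    simp [hA', hx0]
  exact add_pos_of_nonneg_of_pos h4 (mul_pos h5 h3)

/-- Proposition 5.6. If `A` is a `4`-by-`4` symmetric TN (resp. TP)
matrix, then `A^{∘t}` is TN (resp. TP) for every real `t ≥ 2`. -/
theorem hadamard_power_4x4_symm (A : Matrix (Fin 4) (Fin 4) ℝ) (hsym : A.IsSymm)
    (t : ℝ) (ht : 2 ≤ t) :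
    (IsTNr A 4 → IsTNr (hadPow A t) 4) ∧ (IsTPr A 4 → IsTPr (hadPow A t) 4) := by
  constructor
  · intro h k hk f g hf hg
    have hE := entry_nonneg (by norm_num) h
    interval_cases k
    · simp
    · simp [hadPow, Real.rpow_nonneg, hE]
    · have := minor_nonneg (by norm_num) h (hf (show (0 : Fin 2) < 1 by decide))
        (hg (show (0 : Fin 2) < 1 by decide))
      rw [Matrix.det_fin_two]
      simp only [Matrix.submatrix_apply, hadPow, Matrix.of_apply]
      exact sub_nonneg.2 (min_pow t (by linarith) _ _ _ _ (hE _ _) (hE _ _) (hE _ _) (hE _ _) this)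
    · exact three_nonneg t (by linarith) h f g hf hg
    · rw [strictMono_four f hf, strictMono_four g hg, Matrix.submatrix_id_id]
      exact four_nonneg t ht hsym h
  · intro h k hk f g hf hg
    have hE := entry_pos (by norm_num) h
    interval_cases k
    · simp
    · simp [hadPow, Real.rpow_pos_of_pos, hE]
    · have := minor_pos (by norm_num) h (hf (show (0 : Fin 2) < 1 by decide))
        (hg (show (0 : Fin 2) < 1 by decide))
      rw [Matrix.det_fin_two]
      simp only [Matrix.submatrix_apply, hadPow, Matrix.of_apply]
      rw [← Real.mul_rpow (hE _ _).le (hE _ _).le, ← Real.mul_rpow (hE _ _).le (hE _ _).le]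
      exact sub_pos.2 (Real.rpow_lt_rpow (mul_pos (hE _ _) (hE _ _)).le this (by linarith))
    · exact three_min_pos t (by linarith) h f g hf hg
    · rw [strictMono_four f hf, strictMono_four g hg, Matrix.submatrix_id_id]
      exact four_det_pos t ht hsym h
end

section
/- Let r ≥ 3 be an integer and let A be an n-by-n Hankel matrix of real numbers that is TN_r (resp. TP_r). Then for every real number t ≥ r − 2 the Hadamard power A^{∘t} is TN_r (resp. TP_r). -/
theorem hk_det_cons {α : Type*} {m : ℕ} {M : ℕ} (R : α → Fin M → ℝ) (c : Fin (m+1) → Fin M)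
    (q : Fin (m+1)) (a : α) (τ : Fin m → α) :
    (Matrix.of fun i j => R ((Fin.cons a τ : Fin (m+1) → α) i) (c j)).det
      = (-1)^(q:ℕ) * (Matrix.of fun i j => R ((q.insertNth a τ : Fin (m+1) → α) i) (c j)).det := by
  have h := Matrix.det_permute (q.cycleRange)
    (Matrix.of fun i j => R ((Fin.cons a τ : Fin (m+1) → α) i) (c j))
  have h2 : (Matrix.of fun i j => R ((Fin.cons a τ : Fin (m+1) → α) i) (c j)).submatrix
      q.cycleRange id = (Matrix.of fun i j => R ((q.insertNth a τ : Fin (m+1) → α) i) (c j)) := by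
    ext i j
    have := congrFun (Fin.cons_comp_cycleRange a τ q) i
    simp only [Function.comp] at this
    simp [this]
  rw [h2, Fin.sign_cycleRange] at h
  rw [h]
  push_cast
  rw [← mul_assoc, ← mul_pow]
  simp

theorem hk_plucker {m : ℕ} (R : Fin (m+3) → Fin (m+2) → ℝ) (q : Fin (m+1)) :
    (Matrix.of fun i j => R ((q.castSucc.succ).succAbove i) j).det *
      (Matrix.of fun (i : Fin (m+1)) (j : Fin (m+1)) => R i.castSucc.succ j.castSucc).det
    = (Matrix.of fun (i : Fin (m+2)) j => R i.castSucc j).det *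
      (Matrix.of fun (i : Fin (m+1)) (j : Fin (m+1)) =>
        R ((Fin.last m).insertNth (α := fun _ => Fin (m+3)) (Fin.last (m+2))
          (fun i => (q.succAbove i).castSucc.succ) i) j.castSucc).det
    + (Matrix.of fun (i : Fin (m+2)) j => R i.succ j).det *
      (Matrix.of fun (i : Fin (m+1)) (j : Fin (m+1)) =>
        R ((Fin.cons 0 (fun i => (q.succAbove i).castSucc.succ) : Fin (m+1) → Fin (m+3)) i)
          j.castSucc).det := by
  set τ : Fin m → Fin (m+3) := fun i => (q.succAbove i).castSucc.succ with hτ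
  set Mm : Fin (m+3) → ℝ := fun i => (Matrix.of fun a b => R (i.succAbove a) b).det with hM
  set F : Fin (m+3) → ℝ := fun i => (Matrix.of fun (a : Fin (m+1)) (b : Fin (m+1)) =>
     R ((Fin.cons i τ : Fin (m+1) → Fin (m+3)) a) b.castSucc).det with hF
  have hrel : ∀ j, ∑ i : Fin (m+3), (-1:ℝ)^(i:ℕ) * R i j * Mm i = 0 := by
    intro j
    have h0 : (Matrix.of fun (i : Fin (m+3)) (b : Fin (m+3)) =>
        R i ((Fin.cons j id : Fin (m+3) → Fin (m+2)) b)).det = 0 := by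
      apply Matrix.det_zero_of_column_eq (i := 0) (j := j.succ) (Fin.succ_ne_zero j).symm
      intro k
      simp
    rw [Matrix.det_succ_column_zero] at h0
    rw [← h0]
    apply Finset.sum_congr rfl
    intro i _
    simp [hM, Matrix.submatrix]
  have hFlin : ∃ w : Fin (m+1) → ℝ, ∀ i, F i = ∑ b, R i b.castSucc * w b := by
    refine ⟨fun b => (-1)^(b:ℕ) *
      (Matrix.of fun a c => R (τ a) (b.succAbove c).castSucc).det, fun i => ?_⟩
    simp only [hF]
    rw [Matrix.det_succ_row_zero]
    apply Finset.sum_congr rfl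
    intro b _
    simp [Matrix.submatrix]
    ring
  obtain ⟨w, hw⟩ := hFlin
  have hsum : ∑ i : Fin (m+3), (-1:ℝ)^(i:ℕ) * Mm i * F i = 0 := by
    calc ∑ i : Fin (m+3), (-1:ℝ)^(i:ℕ) * Mm i * F i
        = ∑ i : Fin (m+3), ∑ b : Fin (m+1), w b * ((-1:ℝ)^(i:ℕ) * R i b.castSucc * Mm i) := by
          apply Finset.sum_congr rfl
          intro i _
          rw [hw, Finset.mul_sum]
          apply Finset.sum_congr rfl
          intro b _
          ring
      _ = 0 := by
          rw [Finset.sum_comm]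
          apply Finset.sum_eq_zero
          intro b _
          rw [← Finset.mul_sum, hrel, mul_zero]
  have hz : ∀ i, F (τ i) = 0 := by
    intro i
    apply Matrix.det_zero_of_row_eq (i := 0) (j := i.succ) (Fin.succ_ne_zero i).symm
    ext b
    simp
  rw [Fin.sum_univ_succ, Fin.sum_univ_castSucc, Fin.sum_univ_succAbove _ q] at hsum
  have hz2 : ∑ i : Fin m, (-1:ℝ)^((q.succAbove i).castSucc.succ : ℕ) *
      Mm (q.succAbove i).castSucc.succ * F (q.succAbove i).castSucc.succ = 0 := by
    apply Finset.sum_eq_zero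
    intro i _
    have := hz i
    simp only [hτ] at this
    rw [this, mul_zero]
  rw [hz2] at hsum
  have hq := hk_det_cons R (Fin.castSucc) q q.castSucc.succ τ
  have hl := hk_det_cons R (Fin.castSucc) (Fin.last m) (Fin.last (m+2)) τ
  have hins : (q.insertNth (α := fun _ => Fin (m+3)) q.castSucc.succ τ) = fun i => i.castSucc.succ := by
    ext i
    rcases Fin.eq_self_or_eq_succAbove q i with h | ⟨j, h⟩
    · subst h; simp
    · subst h; simp [hτ]
  rw [hins] at hq
  have hFq : F q.castSucc.succ = _ := hq
  have hFl : F (Fin.last (m+1)).succ = _ := hl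
  rw [hFq, hFl] at hsum
  have hm1 : Mm 0 = (Matrix.of fun (i : Fin (m+2)) j => R i.succ j).det := by
    simp [hM]
  have hm2 : Mm (Fin.last (m+1)).succ = (Matrix.of fun (i : Fin (m+2)) j => R i.castSucc j).det := by
    simp [hM]
  have hF0 : F 0 = (Matrix.of fun (i : Fin (m+1)) (j : Fin (m+1)) =>
        R ((Fin.cons 0 τ : Fin (m+1) → Fin (m+3)) i) j.castSucc).det := rfl
  rw [hm1, hm2, hF0] at hsum
  have e1 : (-1:ℝ)^((q.castSucc.succ : Fin (m+3)) : ℕ) = - (-1)^(q:ℕ) := by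
    simp [pow_succ]
  have e2 : (-1:ℝ)^(((Fin.last (m+1)).succ : Fin (m+3)) : ℕ) = (-1)^m := by
    simp [pow_succ]
  have e3 : ((-1:ℝ)^(q:ℕ)) * (-1)^(q:ℕ) = 1 := by rw [← mul_pow]; simp
  have e4 : ((-1:ℝ)^m) * (-1)^m = 1 := by rw [← mul_pow]; simp
  rw [e1, e2] at hsum
  simp only [Fin.val_zero, pow_zero, one_mul, Fin.val_last] at hsum
  have hMq : (Matrix.of fun i j => R ((q.castSucc.succ).succAbove i) j).det = Mm q.castSucc.succ := rfl
  rw [hMq]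
  linear_combination (-1) * hsum - (Mm q.castSucc.succ * (Matrix.of fun (i : Fin (m+1)) (j : Fin (m+1)) => R i.castSucc.succ j.castSucc).det) * e3 + ((Matrix.of fun (i : Fin (m+2)) j => R i.castSucc j).det *
      (Matrix.of fun (i : Fin (m+1)) (j : Fin (m+1)) =>
        R ((Fin.last m).insertNth (α := fun _ => Fin (m+3)) (Fin.last (m+2))
          τ i) j.castSucc).det) * e4

theorem hk_fekete_step {m N : ℕ} (W : ℕ → Fin (m+2) → ℝ)
    (h1 : ∀ f : Fin (m+1) → ℕ, StrictMono f → (∀ i, f i < N) →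
      0 < (Matrix.of fun i j : Fin (m+1) => W (f i) j.castSucc).det)
    (h2 : ∀ a, a + (m+2) ≤ N → 0 < (Matrix.of fun i j : Fin (m+2) => W (a + i) j).det) :
    ∀ (d : ℕ) (f : Fin (m+2) → ℕ), StrictMono f → (∀ i, f i < N) → f (Fin.last _) - f 0 ≤ d →
      0 < (Matrix.of fun i j : Fin (m+2) => W (f i) j).det := by
  intro d
  induction d with
  | zero =>
    intro f hf _ hd
    have := hf (Fin.last_pos : (0 : Fin (m+2)) < Fin.last (m+1))
    omega
  | succ d ih =>
    intro f hf hN hd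
    by_cases hc : ∀ i : Fin (m+1), f i.succ = f i.castSucc + 1
    · have hfi : ∀ i : Fin (m+2), f i = f 0 + i := by
        intro i
        induction i using Fin.induction with
        | zero => simp
        | succ i ihi => rw [hc, ihi]; simp [add_assoc]
      have := h2 (f 0) (by have := hN (Fin.last _); rw [hfi] at this; simp at this; omega)
      simpa only [← hfi] using this
    · push Not at hc
      obtain ⟨q, hq⟩ := hc
      have hlt : f q.castSucc < f q.succ := hf Fin.castSucc_lt_succ
      set u : Fin (m+3) → ℕ :=
        Fin.insertNth (α := fun _ => ℕ) q.castSucc.succ (f q.castSucc + 1) f with hu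
      have hum : StrictMono u := Fin.strictMono_insertNth hf q _ (by omega) (by omega)
      have hus : ∀ i, u (q.castSucc.succ.succAbove i) = f i := by
        intro i; simp [hu]
      have huN : ∀ i, u i < N := by
        intro i
        rcases Fin.eq_self_or_eq_succAbove q.castSucc.succ i with h | ⟨j, h⟩
        · rw [h]; simp only [hu, Fin.insertNth_apply_same]
          have := hN q.succ; omega
        · rw [h, hus]; exact hN j
      have hu0 : u 0 = f 0 := by
        rw [← hus 0]; simp
      have hul : u (Fin.last _) = f (Fin.last _) := by
        rw [← hus (Fin.last _)]
        congr 1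
        rw [Fin.succAbove_of_lt_succ _ _ (by rw [Fin.lt_def]; simp; omega)]
        rfl
      have hd' := hf (Fin.last_pos : (0 : Fin (m+2)) < Fin.last (m+1))
      have key := hk_plucker (fun i j => W (u i) j) q
      simp only [hus] at key
      have hτ : StrictMono (fun i : Fin m => (q.succAbove i).castSucc.succ) := by
        intro a b hab
        simpa using hab
      have p1 := h1 (fun i => u i.castSucc.succ)
        (fun a b hab => hum (by simpa using hab)) (fun i => huN _)
      have p2 := h1 (fun i => u ((Fin.last m).insertNth (α := fun _ => Fin (m+3)) (Fin.last (m+2))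
          (fun i => (q.succAbove i).castSucc.succ) i)) (by
            apply hum.comp
            rw [Fin.strictMono_insertNth_iff]
            refine ⟨hτ, fun i _ => ?_, fun i hi => ?_⟩
            · rw [Fin.lt_def]; simp; omega
            · exact absurd hi (not_le.mpr (Fin.castSucc_lt_last i))) (fun i => huN _)
      have p3 := h1 (fun i => u ((Fin.cons 0 (fun i => (q.succAbove i).castSucc.succ) : Fin (m+1) → Fin (m+3)) i)) (by
            apply hum.comp
            rw [← Fin.insertNth_zero', Fin.strictMono_insertNth_iff]
            refine ⟨hτ, fun i hi => ?_, fun i hi => ?_⟩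
            · exact absurd hi (by simp)
            · exact Fin.succ_pos _) (fun i => huN _)
      have p4 := ih (fun i => u i.castSucc) (fun a b hab => hum (by simpa using hab))
        (fun i => huN _) (by
          have : u (Fin.last (m+1)).castSucc < u (Fin.last (m+2)) := hum (Fin.castSucc_lt_last _)
          simp only [Fin.castSucc_zero]
          omega)
      have p5 := ih (fun i => u i.succ) (fun a b hab => hum (by simpa using hab))
        (fun i => huN _) (by
          have : u 0 < u (Fin.succ 0) := hum (Fin.succ_pos _)
          have e : u (Fin.last (m+1)).succ = u (Fin.last (m+2)) := rfl
          omega)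
      have hpos := add_pos (mul_pos p4 p2) (mul_pos p5 p3)
      rw [← key] at hpos
      exact (pos_iff_pos_of_mul_pos hpos).mpr p1

theorem hk_fekete {r N : ℕ} (X : ℕ → ℕ → ℝ)
    (hX : ∀ k ≤ r, ∀ a b, a + k ≤ N → b + k ≤ N →
      0 < (Matrix.of fun i j : Fin k => X (a + i) (b + j)).det) :
    ∀ k ≤ r, ∀ f g : Fin k → ℕ, StrictMono f → StrictMono g → (∀ i, f i < N) → (∀ i, g i < N) →
      0 < (Matrix.of fun i j : Fin k => X (f i) (g j)).det := by
  have P : ∀ k ≤ r, ∀ (f : Fin k → ℕ) (b : ℕ), StrictMono f → (∀ i, f i < N) → b + k ≤ N →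
      0 < (Matrix.of fun i j : Fin k => X (f i) (b + j)).det := by
    intro k
    induction k with
    | zero => intro _ f b _ _ _; simp
    | succ k ih =>
      intro hk f b hf hN hb
      rcases k with _ | m
      · have := hX 1 hk (f 0) b (by have := hN 0; omega) hb
        simpa using this
      · refine hk_fekete_step (N := N) (fun i j => X i (b + j)) ?_ ?_ _ f hf hN le_rfl
        · intro f' hf' hN'
          exact ih (by omega) f' b hf' hN' (by omega)
        · intro a ha
          exact hX _ hk a b ha hb
  intro k
  induction k with
  | zero => intro _ f g _ _ _ _; simp
  | succ k ih =>
    intro hk f g hf hg hfN hgN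
    rcases k with _ | m
    · have := hX 1 hk (f 0) (g 0) (by have := hfN 0; omega) (by have := hgN 0; omega)
      simpa using this
    · have := hk_fekete_step (N := N) (fun i (j : Fin (m+2)) => X (f j) i) ?_ ?_ _ g hg hgN le_rfl
      · rw [← Matrix.det_transpose]
        exact this
      · intro g' hg' hN'
        rw [← Matrix.det_transpose]
        exact ih (by omega) (fun i => f i.castSucc) g' (fun a b hab => hf (by simpa using hab)) hg'
          (fun i => hfN _) hN'
      · intro a ha
        rw [← Matrix.det_transpose]
        exact P _ hk f a hf hfN ha

/-- The quadratic form of a matrix. -/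
def hkQ {k : ℕ} (A : Matrix (Fin k) (Fin k) ℝ) (v : Fin k → ℝ) : ℝ :=
  ∑ i, ∑ j, v i * A i j * v j

theorem hkQ_eq {k : ℕ} (A : Matrix (Fin k) (Fin k) ℝ) (v : Fin k → ℝ) :
    star v ⬝ᵥ (A.mulVec v) = hkQ A v := by
  simp [hkQ, dotProduct, Matrix.mulVec, Finset.mul_sum, mul_assoc]

theorem hk_posSemidef {k : ℕ} {A : Matrix (Fin k) (Fin k) ℝ} (hs : ∀ i j, A i j = A j i)
    (h : ∀ v, 0 ≤ hkQ A v) : A.PosSemidef := by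
  apply Matrix.PosSemidef.of_dotProduct_mulVec_nonneg
  · ext i j; simp [hs j i]
  · intro v; rw [hkQ_eq]; exact h v

theorem hk_posDef {k : ℕ} {A : Matrix (Fin k) (Fin k) ℝ} (hs : ∀ i j, A i j = A j i)
    (h : ∀ v, v ≠ 0 → 0 < hkQ A v) : A.PosDef := by
  apply Matrix.PosDef.of_dotProduct_mulVec_pos
  · ext i j; simp [hs j i]
  · intro v hv; rw [hkQ_eq]; exact h v hv

theorem hk_posDef_pos {k : ℕ} {A : Matrix (Fin k) (Fin k) ℝ} (h : A.PosDef)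
    {v : Fin k → ℝ} (hv : v ≠ 0) : 0 < hkQ A v := by
  rw [← hkQ_eq]; exact h.dotProduct_mulVec_pos hv

theorem hk_posDef_symm {k : ℕ} {A : Matrix (Fin k) (Fin k) ℝ} (h : A.PosDef) (i j : Fin k) :
    A i j = A j i := by
  have := h.isHermitian.apply i j
  simpa using this.symm

/-- The Schur complement of the `(0,0)` entry. -/
noncomputable def hkS {k : ℕ} (A : Matrix (Fin (k+1)) (Fin (k+1)) ℝ) : Matrix (Fin k) (Fin k) ℝ :=
  Matrix.of fun i j => A i.succ j.succ - A i.succ 0 * A 0 j.succ / A 0 0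

theorem hk_det_schur {k : ℕ} (A : Matrix (Fin (k+1)) (Fin (k+1)) ℝ) (ha : A 0 0 ≠ 0) :
    A.det = A 0 0 * (hkS A).det := by
  set c : Fin (k+1) → ℝ := Fin.cons 0 (fun i => - A i.succ 0 / A 0 0) with hc
  set B : Matrix (Fin (k+1)) (Fin (k+1)) ℝ := Matrix.of fun i j => A i j + c i * A 0 j with hB
  have h1 : B.det = A.det :=
    Matrix.det_eq_of_forall_row_eq_smul_add_const c 0 (by simp [hc]) (fun i j => rfl)
  rw [← h1, Matrix.det_succ_column_zero, Fin.sum_univ_succ, Finset.sum_eq_zero]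
  · have : B.submatrix (Fin.succAbove 0) Fin.succ = hkS A := by
      ext i j
      simp [hB, hc, hkS]
      ring
    rw [this]
    simp [hB, hc]
  · intro i _
    have : B i.succ 0 = 0 := by
      simp [hB, hc]
      field_simp
      ring
    rw [this]; simp

theorem hkQ_schur {k : ℕ} (A : Matrix (Fin (k+1)) (Fin (k+1)) ℝ) (hs : ∀ i j, A i j = A j i)
    (ha : A 0 0 ≠ 0) (v : Fin (k+1) → ℝ) :
    hkQ A v = (∑ j, A 0 j * v j)^2 / A 0 0 + hkQ (hkS A) (fun i => v i.succ) := by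
  set L := ∑ j : Fin k, A 0 j.succ * v j.succ with hL
  have e1 : hkQ A v = A 0 0 * v 0 ^ 2 + 2 * v 0 * L
      + ∑ i : Fin k, ∑ j : Fin k, v i.succ * A i.succ j.succ * v j.succ := by
    simp only [hkQ, Fin.sum_univ_succ]
    rw [Finset.sum_add_distrib]
    have a1 : ∑ j : Fin k, v 0 * A 0 j.succ * v j.succ = v 0 * L := by
      rw [hL, Finset.mul_sum]; exact Finset.sum_congr rfl fun j _ => by ring
    have a2 : ∑ j : Fin k, v j.succ * A j.succ 0 * v 0 = v 0 * L := by
      rw [hL, Finset.mul_sum]; exact Finset.sum_congr rfl fun j _ => by rw [hs j.succ 0]; ring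
    rw [a1, a2]; ring
  have e2 : hkQ (hkS A) (fun i => v i.succ) =
      (∑ i : Fin k, ∑ j : Fin k, v i.succ * A i.succ j.succ * v j.succ) - L^2 / A 0 0 := by
    have : L^2 / A 0 0 = ∑ i : Fin k, ∑ j : Fin k,
        v i.succ * (A i.succ 0 * A 0 j.succ / A 0 0) * v j.succ := by
      rw [pow_two, hL, Finset.sum_mul_sum, Finset.sum_div]
      refine Finset.sum_congr rfl fun i _ => ?_
      rw [Finset.sum_div]
      refine Finset.sum_congr rfl fun j _ => ?_
      rw [hs i.succ 0]; ring
    rw [this, ← Finset.sum_sub_distrib, hkQ]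
    refine Finset.sum_congr rfl fun i _ => ?_
    rw [← Finset.sum_sub_distrib]
    refine Finset.sum_congr rfl fun j _ => ?_
    simp [hkS]; ring
  rw [e1, e2, Fin.sum_univ_succ, ← hL]
  field_simp
  ring

theorem hk_minors_nonneg : ∀ (k : ℕ) (A : Matrix (Fin k) (Fin k) ℝ), (∀ i j, A i j = A j i) →
    (∀ (l : ℕ) (f : Fin l → Fin k), StrictMono f → 0 ≤ (A.submatrix f f).det) →
    ∀ v, 0 ≤ hkQ A v := by
  intro k
  induction k with
  | zero => intro A _ _ v; simp [hkQ]
  | succ k ih =>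
    intro A hs hm v
    have ha : 0 ≤ A 0 0 := by
      have := hm 1 (fun _ => 0) (Subsingleton.strictMono _)
      simpa using this
    rcases ha.eq_or_lt with ha | ha
    · have hz : ∀ j : Fin k, A 0 j.succ = 0 := by
        intro j
        have := hm 2 ![0, j.succ] (by
          intro a b hab
          fin_cases a <;> fin_cases b <;> simp at hab ⊢)
        rw [Matrix.det_fin_two] at this
        simp [← ha, hs j.succ 0] at this
        nlinarith
      have h2 := ih (A.submatrix Fin.succ Fin.succ) (fun i j => hs _ _) (fun l f hf => by
        have := hm l (fun i => (f i).succ) (fun a b hab => by simpa using hf hab)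
        exact this) (fun i => v i.succ)
      have : hkQ A v = hkQ (A.submatrix Fin.succ Fin.succ) (fun i => v i.succ) := by
        simp [hkQ, Fin.sum_univ_succ, ← ha, hz, hs _ 0]
      rw [this]; exact h2
    · rw [hkQ_schur A hs ha.ne']
      refine add_nonneg (by positivity) (ih _ ?_ ?_ _)
      · intro i j
        simp only [hkS, Matrix.of_apply]
        rw [hs i.succ j.succ, hs i.succ 0, hs 0 j.succ]; ring
      · intro l f hf
        set g : Fin (l+1) → Fin (k+1) := Fin.cons 0 (fun i => (f i).succ) with hg
        have hgm : StrictMono g := by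
          rw [hg, ← Fin.insertNth_zero', Fin.strictMono_insertNth_iff]
          refine ⟨fun a b hab => by simpa using hf hab, fun i hi => ?_, fun i hi => ?_⟩
          · exact absurd hi (by simp)
          · exact Fin.succ_pos _
        have h1 := hm _ g hgm
        have h00 : (A.submatrix g g) 0 0 = A 0 0 := by simp [hg]
        rw [hk_det_schur _ (by rw [h00]; exact ha.ne'), h00] at h1
        have h3 : hkS (A.submatrix g g) = (hkS A).submatrix f f := by
          ext i j; simp [hkS, hg]
        rw [h3] at h1
        exact nonneg_of_mul_nonneg_right h1 ha

/-- FitzGerald–Horn type theorem for positive definite matrices with positive entries. -/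
theorem hk_fitzgerald_horn : ∀ (k : ℕ) (A : Matrix (Fin k) (Fin k) ℝ) (t : ℝ), A.PosDef →
    (∀ i j, 0 < A i j) → (k:ℝ) - 2 ≤ t → t ≠ 0 → (A.map (fun x => x ^ t)).PosDef := by
  intro k
  induction k with
  | zero => 
    intro A t _ _ _ _
    exact hk_posDef (fun i => i.elim0) (fun v hv => absurd (Subsingleton.elim v 0) hv)
  | succ k ih =>
    intro A t hA hpos ht ht0
    have hs := hk_posDef_symm hA
    have ha := hpos 0 0
    refine hk_posDef (fun i j => by simp [hs i j]) (fun v hv => ?_)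
    by_cases hw : (fun i : Fin k => v i.succ) = 0
    · have hv0 : v 0 ≠ 0 := by
        intro h
        apply hv
        ext i
        refine Fin.cases h (fun i => congrFun hw i) i
      have hw' : ∀ i : Fin k, v i.succ = 0 := fun i => congrFun hw i
      simp only [hkQ, Fin.sum_univ_succ, hw', Matrix.map_apply]
      simp
      have := Real.rpow_pos_of_pos ha t
      have h2 : 0 < v 0 ^ 2 := by positivity
      nlinarith
    · have hk : 1 ≤ k := by
        rcases k with _ | k
        · exact absurd (Subsingleton.elim _ _) hw
        · omega
      have hk' : (1:ℝ) ≤ k := by exact_mod_cast hk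
      have htpos : 0 < t := lt_of_le_of_ne (by push_cast at ht; linarith) ht0.symm
      -- the rank one matrix
      set ξ : Fin (k+1) → ℝ := fun i => A 0 i with hξ
      set P : Matrix (Fin (k+1)) (Fin (k+1)) ℝ := Matrix.of fun i j => A 0 i * A 0 j / A 0 0 with hP
      have hPpos : ∀ i j, 0 < P i j := fun i j => div_pos (mul_pos (hpos _ _) (hpos _ _)) ha
      set C : ℝ → Fin (k+1) → Fin (k+1) → ℝ := fun l i j => P i j + l * (A i j - P i j) with hC
      have hCpos : ∀ l, 0 ≤ l → l ≤ 1 → ∀ i j, 0 < C l i j := by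
        intro l h0 h1 i j
        have e : C l i j = (1 - l) * P i j + l * A i j := by simp only [hC]; ring
        rw [e]
        rcases h0.eq_or_lt with h | h
        · rw [← h]; simpa using hPpos i j
        · exact add_pos_of_nonneg_of_pos (mul_nonneg (by linarith) (hPpos i j).le)
            (mul_pos h (hpos i j))
      have hS : (hkS A).PosDef := by
        refine hk_posDef (fun i j => ?_) (fun w hw => ?_)
        · simp only [hkS, Matrix.of_apply]
          rw [hs i.succ j.succ, hs i.succ 0, hs 0 j.succ]; ring
        · set u : Fin (k+1) → ℝ := Fin.cons (-(∑ j : Fin k, A 0 j.succ * w j) / A 0 0) w with hu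
          have hune : u ≠ 0 := by
            intro h
            apply hw
            ext i
            have := congrFun h i.succ
            simpa [hu] using this
          have h1 := hk_posDef_pos hA hune
          rw [hkQ_schur A hs ha.ne'] at h1
          have h2 : ∑ j, A 0 j * u j = 0 := by
            rw [Fin.sum_univ_succ]
            simp [hu]
            field_simp
            ring
          rw [h2] at h1
          simpa [hu] using h1
      set g : ℝ → ℝ := fun l => ∑ i, ∑ j, v i * (C l i j) ^ t * v j with hg
      have hder : ∀ l ∈ Set.Icc (0:ℝ) 1, HasDerivAt g
          (∑ i, ∑ j, v i * ((A i j - P i j) * t * (C l i j) ^ (t-1)) * v j) l := by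
        intro l hl
        simp only [hg]
        refine HasDerivAt.fun_sum fun i _ => HasDerivAt.fun_sum fun j _ => ?_
        refine HasDerivAt.mul_const (HasDerivAt.const_mul _ ?_) _
        refine HasDerivAt.rpow_const ?_ (Or.inl (hCpos l hl.1 hl.2 i j).ne')
        simp only [hC]
        have := ((hasDerivAt_id l).mul_const (A i j - P i j)).const_add (P i j)
        simpa using this
      have hdpos : ∀ l ∈ Set.Ioo (0:ℝ) 1, 
          0 < (∑ i, ∑ j, v i * ((A i j - P i j) * t * (C l i j) ^ (t-1)) * v j) := by
        intro l hl
        set D : Matrix (Fin k) (Fin k) ℝ := Matrix.of fun i j => C l i.succ j.succ with hD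
        have hDpos : ∀ i j, 0 < D i j := fun i j => hCpos l hl.1.le hl.2.le _ _
        have hDsch : ∀ i j, D i j = l * hkS A i j + A 0 i.succ * A 0 j.succ / A 0 0 := by
          intro i j
          simp only [hD, hC, hP, hkS, Matrix.of_apply]
          rw [hs i.succ 0]; ring
        have hDpd : D.PosDef := by
          refine hk_posDef (fun i j => ?_) (fun w hw => ?_)
          · rw [hDsch, hDsch, hk_posDef_symm hS i j]; ring
          · have e : hkQ D w = l * hkQ (hkS A) w + (∑ i : Fin k, A 0 i.succ * w i)^2 / A 0 0 := by
              rw [pow_two, Finset.sum_mul_sum, Finset.sum_div]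
              simp only [hkQ]
              rw [Finset.mul_sum, ← Finset.sum_add_distrib]
              refine Finset.sum_congr rfl fun i _ => ?_
              rw [Finset.mul_sum, Finset.sum_div, ← Finset.sum_add_distrib]
              refine Finset.sum_congr rfl fun j _ => ?_
              rw [hDsch]; ring
            rw [e]
            exact add_pos_of_pos_of_nonneg (mul_pos hl.1 (hk_posDef_pos hS hw)) (by positivity)
        have hH : (Matrix.of fun i j => hkS A i j * (D i j) ^ (t-1)).PosDef := by
          by_cases ht1 : t = 1
          · have : (Matrix.of fun i j => hkS A i j * (D i j) ^ (t-1)) = hkS A := by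
              ext i j; simp [ht1]
            rw [this]; exact hS
          · exact hS.hadamard (ih D (t-1) hDpd hDpos (by push_cast at ht; linarith)
              (sub_ne_zero.mpr ht1))
        have h1 := mul_pos htpos (hk_posDef_pos hH hw)
        have hz1 : ∀ j, A 0 j - P 0 j = 0 := by
          intro j; simp only [hP, Matrix.of_apply]; field_simp; ring
        have hz2 : ∀ j, A j 0 - P j 0 = 0 := by
          intro j; simp only [hP, Matrix.of_apply]; rw [hs j 0]; field_simp; ring
        refine lt_of_lt_of_eq h1 ?_
        symm
        simp only [Fin.sum_univ_succ, hz1, hz2, hkQ, Finset.mul_sum]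
        simp
        refine Finset.sum_congr rfl fun i _ => Finset.sum_congr rfl fun j _ => ?_
        simp only [hD, hkS, hP, Matrix.of_apply]
        rw [hs i.succ 0]
        ring
      have hmono : StrictMonoOn g (Set.Icc 0 1) := by
        refine strictMonoOn_of_deriv_pos (convex_Icc 0 1)
          (fun l hl => (hder l hl).continuousAt.continuousWithinAt) (fun l hl => ?_)
        rw [interior_Icc] at hl
        rw [(hder l (Set.Ioo_subset_Icc_self hl)).deriv]
        exact hdpos l hl
      have h01 := hmono (Set.left_mem_Icc.mpr zero_le_one) (Set.right_mem_Icc.mpr zero_le_one)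
        zero_lt_one
      have hg1 : g 1 = hkQ (A.map (fun x => x ^ t)) v := by
        simp [hg, hC, hkQ]
      have hg0 : g 0 = (∑ i, v i * (A 0 i) ^ t) ^ 2 / (A 0 0) ^ t := by
        simp only [hg, hC, hP]
        rw [pow_two, Finset.sum_mul_sum, Finset.sum_div]
        refine Finset.sum_congr rfl fun i _ => ?_
        rw [Finset.sum_div]
        refine Finset.sum_congr rfl fun j _ => ?_
        simp only [zero_mul, add_zero, Matrix.of_apply]
        rw [Real.div_rpow (mul_pos (hpos _ _) (hpos _ _)).le ha.le,
          Real.mul_rpow (hpos _ _).le (hpos _ _).le]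
        ring
      rw [← hg1]
      refine lt_of_le_of_lt ?_ h01
      rw [hg0]
      have := Real.rpow_pos_of_pos ha t
      positivity

/-- Contiguous Hankel blocks of a positive sequence: Fekete plus FitzGerald–Horn. -/
theorem hk_power_TP {r n : ℕ} (h : ℕ → ℝ) (t : ℝ) (ht : (r:ℝ) - 2 ≤ t) (ht0 : t ≠ 0)
    (hpos : ∀ s, s + 2 ≤ 2 * n → 0 < h s)
    (hpd : ∀ k ≤ r, ∀ s, s + 2 * k ≤ 2 * n →
      (Matrix.of fun i j : Fin k => h (s + i + j)).PosDef) :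
    ∀ k ≤ r, ∀ f g : Fin k → ℕ, StrictMono f → StrictMono g → (∀ i, f i < n) → (∀ i, g i < n) →
      0 < (Matrix.of fun i j : Fin k => (h (f i + g j)) ^ t).det := by
  refine hk_fekete (r := r) (N := n) (fun a b => (h (a + b)) ^ t) ?_
  intro k hk a b ha hb
  have h1 := hk_fitzgerald_horn k _ t (hpd k hk (a + b) (by omega))
    (fun i j => hpos _ (by omega)) (by
      have : (k:ℝ) ≤ r := by exact_mod_cast hk
      linarith) ht0
  have h2 := h1.det_pos
  refine lt_of_lt_of_eq h2 (congrArg Matrix.det ?_)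
  ext i j
  simp only [Matrix.map_apply, Matrix.of_apply]
  congr 2
  omega

theorem hk_exists_seq {n : ℕ} (A : Matrix (Fin n) (Fin n) ℝ) (hH : IsHankel A) :
    ∃ h : ℕ → ℝ, ∀ i j, A i j = h (i.1 + j.1) := by
  classical
  refine ⟨fun s => if hs : ∃ p : Fin n × Fin n, p.1.1 + p.2.1 = s then
    A hs.choose.1 hs.choose.2 else 0, fun i j => ?_⟩
  have hs : ∃ p : Fin n × Fin n, p.1.1 + p.2.1 = i.1 + j.1 := ⟨(i, j), rfl⟩
  simp only [dif_pos hs]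
  exact hH _ _ _ _ hs.choose_spec.symm

/-- A TN_r Hankel matrix has positive semidefinite contiguous blocks. -/
theorem hk_block_psd {r n : ℕ} {A : Matrix (Fin n) (Fin n) ℝ} {h : ℕ → ℝ}
    (hA : ∀ i j, A i j = h (i.1 + j.1)) (hT : IsTNr A r) (k : ℕ) (hk : k ≤ r) (s : ℕ)
    (hs : s + 2 * k ≤ 2 * n) :
    (Matrix.of fun i j : Fin k => h (s + i + j)).PosSemidef := by
  have hsym : ∀ i j : Fin k, h (s + i + j) = h (s + j + i) := fun i j => by congr 1; omega
  refine hk_posSemidef hsym (hk_minors_nonneg k _ hsym ?_)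
  intro l f hf
  have hlk : l ≤ k := by
    simpa using Fintype.card_le_of_injective f hf.injective
  -- split the offset
  obtain ⟨a, b, hab, ha, hb⟩ : ∃ a b, a + b = s ∧ a + k ≤ n ∧ b + k ≤ n :=
    ⟨s / 2, s - s / 2, by omega, by omega, by omega⟩
  have := hT l (by omega) (fun i => ⟨a + f i, by omega⟩) (fun i => ⟨b + f i, by omega⟩)
    (fun x y hxy => by have := hf hxy; rw [Fin.lt_def] at this ⊢; simp; omega)
    (fun x y hxy => by have := hf hxy; rw [Fin.lt_def] at this ⊢; simp; omega)
  refine le_of_le_of_eq this (congrArg Matrix.det ?_)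
  ext i j
  simp only [Matrix.submatrix_apply, Matrix.of_apply, hA]
  congr 1
  omega

/-- A strictly positive moment sequence. -/
noncomputable def hkMom (n s : ℕ) : ℝ := ∑ l : Fin (n+1), ((l:ℝ) + 1) ^ s

theorem hkMom_pos (n s : ℕ) : 0 < hkMom n s := by
  refine Finset.sum_pos (fun l _ => by positivity) ⟨0, Finset.mem_univ _⟩

theorem hkMom_posDef (n k s : ℕ) (hk : k ≤ n) :
    (Matrix.of fun i j : Fin k => hkMom n (s + i + j)).PosDef := by
  refine hk_posDef (fun i j => ?_) (fun v hv => ?_)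
  · simp only [Matrix.of_apply]; congr 1; omega
  · have e : hkQ (Matrix.of fun i j : Fin k => hkMom n (s + i + j)) v
        = ∑ l : Fin (n+1), ((l:ℝ) + 1) ^ s * (∑ i : Fin k, v i * ((l:ℝ) + 1) ^ (i:ℕ)) ^ 2 := by
      simp only [hkQ, hkMom, Matrix.of_apply, pow_two, Finset.mul_sum,
        Finset.sum_mul]
      rw [Finset.sum_comm' (t' := Finset.univ) (s' := fun _ => Finset.univ) (by simp)]
      rw [Finset.sum_comm]
      simp_rw [Finset.sum_comm (s := (Finset.univ : Finset (Fin (n+1))))]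
      refine Finset.sum_congr rfl fun i _ => Finset.sum_congr rfl fun j _ =>
        Finset.sum_congr rfl fun l _ => ?_
      rw [pow_add, pow_add]; ring
    rw [e]
    refine lt_of_le_of_ne (Finset.sum_nonneg fun l _ => by positivity) ?_
    intro h0
    apply hv
    have h1 : ∀ l : Fin (n+1), ∑ i : Fin k, v i * ((l:ℝ) + 1) ^ (i:ℕ) = 0 := by
      intro l
      have := (Finset.sum_eq_zero_iff_of_nonneg (fun l _ => by positivity)).mp h0.symm l
        (Finset.mem_univ l)
      have h2 : (0:ℝ) < ((l:ℝ) + 1) ^ s := by positivity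
      rcases mul_eq_zero.mp this with h | h
      · exact absurd h h2.ne'
      · exact pow_eq_zero_iff (two_ne_zero) |>.mp h
    have h3 := Matrix.eq_zero_of_forall_index_sum_pow_mul_eq_zero (R := ℝ) (n := k)
      (f := fun l : Fin k => (l:ℝ) + 1) (v := v) (by
        intro a b hab
        simpa [Fin.ext_iff] using hab) (by
        intro l
        have := h1 ⟨l, by omega⟩
        simpa [mul_comm] using this)
    exact h3

/-- Theorem 5.11. For every integer `r ≥ 3`: if `A` is a TN_r
(resp. TP_r) Hankel matrix, then `A^{∘t}` is TN_r (resp. TP_r) for every real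
`t ≥ r - 2`. -/
theorem hankel_hadamard_power_TNr_TPr {n : ℕ} (r : ℕ) (hr : 3 ≤ r)
    (A : Matrix (Fin n) (Fin n) ℝ) (hH : IsHankel A)
    (t : ℝ) (ht : (r : ℝ) - 2 ≤ t) :
    (IsTNr A r → IsTNr (hadPow A t) r) ∧ (IsTPr A r → IsTPr (hadPow A t) r) := by
  have hr' : (3:ℝ) ≤ r := by exact_mod_cast hr
  have ht0 : 0 < t := by linarith
  obtain ⟨h, hA⟩ := hk_exists_seq A hH
  constructor
  · intro hT k hk f g hf hg
    have hkn : k ≤ n := by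
      simpa using Fintype.card_le_of_injective f hf.injective
    have hnn : ∀ s, s + 2 ≤ 2 * n → 0 ≤ h s := by
      intro s hs
      have := hk_block_psd hA hT 1 (by omega) s (by omega)
      have := this.diag_nonneg (i := 0)
      simpa using this
    -- perturbed determinant
    have hp : ∀ ε : ℝ, 0 < ε → 0 ≤ (Matrix.of fun i j : Fin k =>
        (h ((f i).1 + (g j).1) + ε * hkMom n ((f i).1 + (g j).1)) ^ t).det := by
      intro ε hε
      refine (hk_power_TP (r := r) (n := n) (fun s => h s + ε * hkMom n s) t ht ht0.ne' ?_ ?_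
        k hk (fun i => (f i).1) (fun i => (g i).1) (fun a b hab => hf hab) (fun a b hab => hg hab)
        (fun i => (f i).2) (fun i => (g i).2)).le
      · intro s hs
        have := hnn s hs
        have := mul_pos hε (hkMom_pos n s)
        linarith
      · intro k hk s hs
        have h1 := hk_block_psd hA hT k hk s hs
        have h2 := (hkMom_posDef n k s (by omega)).smul hε
        exact Matrix.PosDef.posSemidef_add h1 h2
    have hc : Filter.Tendsto (fun ε : ℝ => (Matrix.of fun i j : Fin k =>
        (h ((f i).1 + (g j).1) + ε * hkMom n ((f i).1 + (g j).1)) ^ t).det)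
        (nhdsWithin 0 (Set.Ioi 0)) (nhds ((Matrix.of fun i j : Fin k =>
        (h ((f i).1 + (g j).1) + 0 * hkMom n ((f i).1 + (g j).1)) ^ t).det)) := by
      apply Filter.Tendsto.mono_left _ nhdsWithin_le_nhds
      apply Continuous.tendsto (f := fun ε : ℝ => (Matrix.of fun i j : Fin k =>
        (h ((f i).1 + (g j).1) + ε * hkMom n ((f i).1 + (g j).1)) ^ t).det)
      apply Continuous.matrix_det
      apply continuous_matrix
      intro i j
      simp only [Matrix.of_apply]
      exact Continuous.rpow_const (by fun_prop) (fun _ => Or.inr ht0.le)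
    have hlim := ge_of_tendsto hc (by
      filter_upwards [self_mem_nhdsWithin] with ε hε
      exact hp ε hε)
    refine le_of_le_of_eq hlim (congrArg Matrix.det ?_)
    ext i j
    simp [hadPow, hA]
  · intro hT k hk f g hf hg
    have hTN : IsTNr A r := fun k hk f g hf hg => (hT k hk f g hf hg).le
    have hpd : ∀ k ≤ r, ∀ s, s + 2 * k ≤ 2 * n →
        (Matrix.of fun i j : Fin k => h (s + i + j)).PosDef := by
      intro k hk s hs
      have h1 := hk_block_psd hA hTN k hk s hs
      rw [h1.posDef_iff_det_ne_zero]
      obtain ⟨a, b, hab, ha, hb⟩ : ∃ a b, a + b = s ∧ a + k ≤ n ∧ b + k ≤ n :=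
        ⟨s / 2, s - s / 2, by omega, by omega, by omega⟩
      have := hT k hk (fun i => ⟨a + i, by omega⟩) (fun i => ⟨b + i, by omega⟩)
        (fun x y hxy => by rw [Fin.lt_def] at hxy ⊢; simp; omega)
        (fun x y hxy => by rw [Fin.lt_def] at hxy ⊢; simp; omega)
      refine ne_of_gt ?_
      refine lt_of_lt_of_eq this (congrArg Matrix.det ?_)
      ext i j
      simp only [Matrix.submatrix_apply, Matrix.of_apply, hA]
      congr 1
      omega
    have := hk_power_TP (r := r) (n := n) h t ht ht0.ne' (fun s hs => by
        have := (hpd 1 (by omega) s (by omega)).diag_pos (i := 0)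
        simpa using this) hpd
        k hk (fun i => (f i).1) (fun i => (g i).1) (fun a b hab => hf hab) (fun a b hab => hg hab)
        (fun i => (f i).2) (fun i => (g i).2)
    refine lt_of_lt_of_eq this (congrArg Matrix.det ?_)
    ext i j
    simp [hadPow, hA]
end
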